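/- For every integer k ≥ 1 there exists a constant c'_k > 0 such that the following holds: if P is a finite set of points in ℝ², C is a k-intersecting family of simple curves, and m denotes the sum, over all unordered pairs {γ,γ'} of distinct curves of C, of the number of points of (γ ∩ γ') \ P, then I(P,C) ≤ c'_k · ( |P|^((k+1)/(2k+1)) · m^(k/(2k+1)) + |P| + |C| ). -/

import Mathlib

open scoped Classical

/-- A simple curve: the image of an injective continuous map from [0,1] into ℝ². -/
def IsSimpleCurve (γ : Set (ℝ × ℝ)) : Prop :=
  ∃ f : Set.Icc (0:ℝ) 1 → ℝ × ℝ, Continuous f ∧ Function.Injective f ∧ γ = Set.range f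

/-- A k-intersecting family of simple curves: every member is a simple curve and
any two distinct members intersect in at most k points. -/
def KIntersecting (C : Finset (Set (ℝ × ℝ))) (k : ℕ) : Prop :=
  (∀ γ ∈ C, IsSimpleCurve γ) ∧
  ∀ γ ∈ C, ∀ γ' ∈ C, γ ≠ γ' → (γ ∩ γ').Finite ∧ (γ ∩ γ').ncard ≤ k

/-- The number of incidences between a finite point set P and a finite family of curves C. -/
noncomputable def incidences (P : Finset (ℝ × ℝ)) (C : Finset (Set (ℝ × ℝ))) : ℕ :=
  ∑ γ ∈ C, (P.filter (fun p => p ∈ γ)).card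

namespace PS

/-- orientation determinant -/
def dt (a b c : ℝ × ℝ) : ℝ := (b.1 - a.1) * (c.2 - a.2) - (b.2 - a.2) * (c.1 - a.1)

/-- orientation sign -/
noncomputable def sg (a b c : ℝ × ℝ) : ZMod 2 := if 0 < dt a b c then 1 else 0

/-- crossing indicator of segments ab and cd -/
noncomputable def cx (a b c d : ℝ × ℝ) : ZMod 2 := (sg a b c + sg a b d) * (sg c d a + sg c d b)

/-- indicator of d in the triangle abc -/
noncomputable def inn (a b c d : ℝ × ℝ) : ZMod 2 :=
  (1 + sg a b d + sg b c d) * (1 + sg b c d + sg c a d)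

lemma sg_cyc (a b c : ℝ × ℝ) : sg b c a = sg a b c := by
  have : dt b c a = dt a b c := by unfold dt; ring
  simp [sg, this]

lemma sg_swap {a b c : ℝ × ℝ} (h : dt a b c ≠ 0) : sg b a c = 1 + sg a b c := by
  have h1 : dt b a c = - dt a b c := by unfold dt; ring
  unfold sg
  rw [h1]
  rcases lt_or_gt_of_ne h with h | h
  · rw [if_pos (by linarith), if_neg (by linarith)]; decide
  · rw [if_neg (by linarith), if_pos (by linarith)]; decide

lemma sg_four {a b c d : ℝ × ℝ} (h1 : dt a b c ≠ 0) (h2 : dt a b d ≠ 0) (h3 : dt a c d ≠ 0)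
    (h4 : dt b c d ≠ 0) :
    ¬ (sg b c d = 1 + sg a c d ∧ sg b c d = sg a b d ∧ sg b c d = 1 + sg a b c) := by
  have key : dt b c d - dt a c d + dt a b d - dt a b c = 0 := by unfold dt; ring
  unfold sg
  rintro ⟨e1, e2, e3⟩
  split_ifs at e1 e2 e3 <;>
  first
  | (exfalso; revert e1 e2 e3; decide)
  | (simp only [not_lt] at *
     have l1 := lt_or_gt_of_ne h1
     have l2 := lt_or_gt_of_ne h2
     have l3 := lt_or_gt_of_ne h3
     have l4 := lt_or_gt_of_ne h4
     rcases l1 with l1 | l1 <;> rcases l2 with l2 | l2 <;> rcases l3 with l3 | l3 <;>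
       rcases l4 with l4 | l4 <;> linarith)

lemma sg_eq_iff {x y : ℝ} (hx : x ≠ 0) (hy : y ≠ 0) :
    ((if 0 < x then (1 : ZMod 2) else 0) = (if 0 < y then 1 else 0)) ↔ 0 < x * y := by
  rcases lt_or_gt_of_ne hx with h | h <;> rcases lt_or_gt_of_ne hy with h' | h'
  · simp [not_lt.2 h.le, not_lt.2 h'.le, mul_pos_of_neg_of_neg h h']
  · simp [not_lt.2 h.le, h', not_lt.2 (mul_neg_of_neg_of_pos h h').le]
  · simp [not_lt.2 h'.le, h, not_lt.2 (mul_neg_of_pos_of_neg h h').le]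
  · simp [h', h, mul_pos h h']

lemma sg_five {a b c d e : ℝ × ℝ} (h1 : dt a b c ≠ 0) (h2 : dt a d e ≠ 0) (h3 : dt a b d ≠ 0)
    (h4 : dt a c e ≠ 0) (h5 : dt a b e ≠ 0) (h6 : dt a c d ≠ 0) :
    ¬ (sg a b c = sg a d e ∧ sg a b d ≠ sg a c e ∧ sg a b e = sg a c d) ∧
    ¬ (sg a b c ≠ sg a d e ∧ sg a b d = sg a c e ∧ sg a b e ≠ sg a c d) := by
  have key : dt a b c * dt a d e - dt a b d * dt a c e + dt a b e * dt a c d = 0 := by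
    unfold dt; ring
  have q1 := sg_eq_iff h1 h2
  have q2 := sg_eq_iff h3 h4
  have q3 := sg_eq_iff h5 h6
  have n1 := mul_ne_zero h1 h2
  have n2 := mul_ne_zero h3 h4
  have n3 := mul_ne_zero h5 h6
  unfold sg
  rw [Ne, Ne, Ne, q1, q2, q3]
  refine ⟨?_, ?_⟩
  · rintro ⟨a1, a2, a3⟩
    linarith
  · rintro ⟨a1, a2, a3⟩
    have a1' := lt_of_le_of_ne (not_lt.1 a1) n1
    have a3' := lt_of_le_of_ne (not_lt.1 a3) n3
    linarith

set_option maxRecDepth 100000 in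
set_option maxHeartbeats 4000000 in
set_option synthInstance.maxHeartbeats 400000 in
set_option synthInstance.maxSize 4096 in
lemma tri_dec : ∀ abc abd abe acd ace ade bcd bce bde cde : ZMod 2,
    ¬ (bcd = 1 + acd ∧ bcd = abd ∧ bcd = 1 + abc) →
    ¬ (bce = 1 + ace ∧ bce = abe ∧ bce = 1 + abc) →
    ¬ (bde = 1 + ade ∧ bde = abe ∧ bde = 1 + abd) →
    ¬ (cde = 1 + ade ∧ cde = ace ∧ cde = 1 + acd) →
    ¬ (cde = 1 + bde ∧ cde = bce ∧ cde = 1 + bcd) →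
    (¬ (abc = ade ∧ abd ≠ ace ∧ abe = acd) ∧ ¬ (abc ≠ ade ∧ abd = ace ∧ abe ≠ acd)) →
    (¬ (1 + abc = bde ∧ 1 + abd ≠ bce ∧ 1 + abe = bcd) ∧ ¬ (1 + abc ≠ bde ∧ 1 + abd = bce ∧ 1 + abe ≠ bcd)) →
    (¬ (abc = cde ∧ 1 + acd ≠ 1 + bce ∧ 1 + ace = 1 + bcd) ∧ ¬ (abc ≠ cde ∧ 1 + acd = 1 + bce ∧ 1 + ace ≠ 1 + bcd)) →
    (¬ (abd = 1 + cde ∧ acd ≠ 1 + bde ∧ 1 + ade = bcd) ∧ ¬ (abd ≠ 1 + cde ∧ acd = 1 + bde ∧ 1 + ade ≠ bcd)) →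
    (¬ (abe = cde ∧ ace ≠ bde ∧ ade = bce) ∧ ¬ (abe ≠ cde ∧ ace = bde ∧ ade ≠ bce)) →
    (abd + abe) * (ade + bde) + (bcd + bce) * (bde + cde) + (1 + acd + (1 + ace)) * (cde + ade) =
      (1 + abd + bcd) * (1 + bcd + (1 + acd)) + (1 + abe + bce) * (1 + bce + (1 + ace)) := by
  decide

set_option maxRecDepth 100000 in
set_option maxHeartbeats 4000000 in
set_option synthInstance.maxHeartbeats 400000 in
set_option synthInstance.maxSize 4096 in
lemma k5_dec : ∀ abc abd abe acd ace ade bcd bce bde cde : ZMod 2,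
    ¬ (bcd = 1 + acd ∧ bcd = abd ∧ bcd = 1 + abc) →
    ¬ (bce = 1 + ace ∧ bce = abe ∧ bce = 1 + abc) →
    ¬ (bde = 1 + ade ∧ bde = abe ∧ bde = 1 + abd) →
    ¬ (cde = 1 + ade ∧ cde = ace ∧ cde = 1 + acd) →
    ¬ (cde = 1 + bde ∧ cde = bce ∧ cde = 1 + bcd) →
    (¬ (abc = ade ∧ abd ≠ ace ∧ abe = acd) ∧ ¬ (abc ≠ ade ∧ abd = ace ∧ abe ≠ acd)) →
    ((abc + abd) * (acd + bcd) + (1 + abc + acd) * (abd + (1 + bcd)) + (1 + abd + (1 + acd)) * (abc + bcd)) +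
     ((abc + abe) * (ace + bce) + (1 + abc + ace) * (abe + (1 + bce)) + (1 + abe + (1 + ace)) * (abc + bce)) +
     ((abd + abe) * (ade + bde) + (1 + abd + ade) * (abe + (1 + bde)) + (1 + abe + (1 + ade)) * (abd + bde)) +
     ((acd + ace) * (ade + cde) + (1 + acd + ade) * (ace + (1 + cde)) + (1 + ace + (1 + ade)) * (acd + cde)) +
     ((bcd + bce) * (bde + cde) + (1 + bcd + bde) * (bce + (1 + cde)) + (1 + bce + (1 + bde)) * (bcd + cde)) = 1 := by
  decide

end PS

namespace PS

/-- general position -/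
def GP {ι : Type*} (q : ι → ℝ × ℝ) : Prop :=
  ∀ i j k, i ≠ j → i ≠ k → j ≠ k → dt (q i) (q j) (q k) ≠ 0

lemma sg_swap' {a b c : ℝ × ℝ} (h : dt a b c ≠ 0) : sg a c b = 1 + sg a b c := by
  have h2 : dt c a b ≠ 0 := by
    have : dt c a b = dt a b c := by unfold dt; ring
    rwa [this]
  rw [sg_swap h2, ← sg_cyc c a b]

lemma tri_gp {ι : Type*} {q : ι → ℝ × ℝ} (hq : GP q) {a b c d e : ι}
    (ab : a ≠ b) (ac : a ≠ c) (ad : a ≠ d) (ae : a ≠ e) (bc : b ≠ c) (bd : b ≠ d) (be : b ≠ e)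
    (cd : c ≠ d) (ce : c ≠ e) (de : d ≠ e) :
    cx (q a) (q b) (q d) (q e) + cx (q b) (q c) (q d) (q e) + cx (q a) (q c) (q d) (q e) =
      inn (q a) (q b) (q c) (q d) + inn (q a) (q b) (q c) (q e) := by
  have abc := hq a b c ab ac bc
  have abd := hq a b d ab ad bd
  have abe := hq a b e ab ae be
  have acd := hq a c d ac ad cd
  have ace := hq a c e ac ae ce
  have ade := hq a d e ad ae de
  have bcd := hq b c d bc bd cd
  have bce := hq b c e bc be ce
  have bde := hq b d e bd be de
  have cde := hq c d e cd ce de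
  have key := tri_dec _ _ _ _ _ _ _ _ _ _ (sg_four abc abd acd bcd) (sg_four abc abe ace bce)
    (sg_four abd abe ade bde) (sg_four acd ace ade cde) (sg_four bcd bce bde cde)
    (sg_five abc ade abd ace abe acd)
    (by
      have := sg_five (hq b a c ab.symm bc ac) bde (hq b a d ab.symm bd ad) bce
        (hq b a e ab.symm be ae) bcd
      rwa [sg_swap abc, sg_swap abd, sg_swap abe] at this)
    (by
      have := sg_five (hq c a b ac.symm bc.symm ab) cde (hq c a d ac.symm cd ad)
        (hq c b e bc.symm ce be) (hq c a e ac.symm ce ae) (hq c b d bc.symm cd bd)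
      rwa [← sg_cyc (q c) (q a) (q b), sg_swap acd, sg_swap bce, sg_swap ace, sg_swap bcd] at this)
    (by
      have := sg_five (hq d a b ad.symm bd.symm ab) (hq d c e cd.symm de ce) (hq d a c ad.symm cd.symm ac)
        (hq d b e bd.symm de be) (hq d a e ad.symm de ae) (hq d b c bd.symm cd.symm bc)
      rwa [← sg_cyc (q d) (q a) (q b), sg_swap cde, ← sg_cyc (q d) (q a) (q c), sg_swap bde,
        sg_swap ade, ← sg_cyc (q d) (q b) (q c)] at this)
    (by
      have := sg_five (hq e a b ae.symm be.symm ab) (hq e c d ce.symm de.symm cd)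
        (hq e a c ae.symm ce.symm ac)
        (hq e b d be.symm de.symm bd) (hq e a d ae.symm de.symm ad) (hq e b c be.symm ce.symm bc)
      rwa [← sg_cyc (q e) (q a) (q b), ← sg_cyc (q e) (q c) (q d), ← sg_cyc (q e) (q a) (q c),
        ← sg_cyc (q e) (q b) (q d), ← sg_cyc (q e) (q a) (q d), ← sg_cyc (q e) (q b) (q c)] at this)
  unfold cx inn
  rw [sg_swap acd, sg_swap ace, sg_cyc (q a) (q d) (q e), sg_cyc (q b) (q d) (q e),
    sg_cyc (q c) (q d) (q e), ← key]
  have two : (2 : ZMod 2) = 0 := rfl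
  linear_combination (-(sg (q c) (q d) (q e) + sg (q a) (q d) (q e))) * two

lemma k5_four {ι : Type*} {q : ι → ℝ × ℝ} (hq : GP q) {a b c d : ι}
    (ab : a ≠ b) (ac : a ≠ c) (ad : a ≠ d) (bc : b ≠ c) (bd : b ≠ d) (cd : c ≠ d) :
    cx (q a) (q b) (q c) (q d) + cx (q a) (q c) (q b) (q d) + cx (q a) (q d) (q b) (q c) =
    ((sg (q a) (q b) (q c) + sg (q a) (q b) (q d)) * (sg (q a) (q c) (q d) + sg (q b) (q c) (q d)) +
     (1 + sg (q a) (q b) (q c) + sg (q a) (q c) (q d)) * (sg (q a) (q b) (q d) + (1 + sg (q b) (q c) (q d))) +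
      (1 + sg (q a) (q b) (q d) + (1 + sg (q a) (q c) (q d))) * (sg (q a) (q b) (q c) + sg (q b) (q c) (q d))) := by
  have abc := hq a b c ab ac bc
  have abd := hq a b d ab ad bd
  have acd := hq a c d ac ad cd
  have bcd := hq b c d bc bd cd
  unfold cx
  rw [sg_swap' abc, sg_swap' abd, sg_swap' acd, sg_swap' bcd, sg_cyc (q a) (q c) (q d),
    sg_cyc (q b) (q c) (q d), sg_cyc (q a) (q b) (q d), sg_cyc (q a) (q b) (q c)]

lemma k5_gp {ι : Type*} {q : ι → ℝ × ℝ} (hq : GP q) {a b c d e : ι}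
    (ab : a ≠ b) (ac : a ≠ c) (ad : a ≠ d) (ae : a ≠ e) (bc : b ≠ c) (bd : b ≠ d) (be : b ≠ e)
    (cd : c ≠ d) (ce : c ≠ e) (de : d ≠ e) :
    (cx (q a) (q b) (q c) (q d) + cx (q a) (q c) (q b) (q d) + cx (q a) (q d) (q b) (q c)) +
    (cx (q a) (q b) (q c) (q e) + cx (q a) (q c) (q b) (q e) + cx (q a) (q e) (q b) (q c)) +
    (cx (q a) (q b) (q d) (q e) + cx (q a) (q d) (q b) (q e) + cx (q a) (q e) (q b) (q d)) +
    (cx (q a) (q c) (q d) (q e) + cx (q a) (q d) (q c) (q e) + cx (q a) (q e) (q c) (q d)) +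
    (cx (q b) (q c) (q d) (q e) + cx (q b) (q d) (q c) (q e) + cx (q b) (q e) (q c) (q d)) = 1 := by
  have abc := hq a b c ab ac bc
  have abd := hq a b d ab ad bd
  have abe := hq a b e ab ae be
  have acd := hq a c d ac ad cd
  have ace := hq a c e ac ae ce
  have ade := hq a d e ad ae de
  have bcd := hq b c d bc bd cd
  have bce := hq b c e bc be ce
  have bde := hq b d e bd be de
  have cde := hq c d e cd ce de
  have key := k5_dec _ _ _ _ _ _ _ _ _ _ (sg_four abc abd acd bcd) (sg_four abc abe ace bce)
    (sg_four abd abe ade bde) (sg_four acd ace ade cde) (sg_four bcd bce bde cde)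
    (sg_five abc ade abd ace abe acd)
  rw [k5_four hq ab ac ad bc bd cd, k5_four hq ab ac ae bc be ce, k5_four hq ab ad ae bd be de,
    k5_four hq ac ad ae cd ce de, k5_four hq bc bd be cd ce de]
  exact key

lemma cx_symm (a b c d : ℝ × ℝ) : cx a b c d = cx c d a b := by
  unfold cx; ring

lemma cx_seg {a b c d : ℝ × ℝ} (h1 : dt a b c ≠ 0) (h2 : dt a b d ≠ 0) (h3 : dt c d a ≠ 0)
    (h4 : dt c d b ≠ 0) (h : cx a b c d ≠ 0) : (segment ℝ a b ∩ segment ℝ c d).Nonempty := by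
  have e1 : sg a b c + sg a b d ≠ 0 := left_ne_zero_of_mul h
  have e2 : sg c d a + sg c d b ≠ 0 := right_ne_zero_of_mul h
  have aux : ∀ x y : ℝ, x ≠ 0 → y ≠ 0 → ((if 0 < x then (1 : ZMod 2) else 0) + (if 0 < y then 1 else 0)) ≠ 0 →
      0 < x / (x - y) ∧ 0 < -y / (x - y) ∧ x - y ≠ 0 := by
    intro x y hx hy hne
    rcases lt_or_gt_of_ne hx with h | h <;> rcases lt_or_gt_of_ne hy with h' | h'
    · simp [not_lt.2 h.le, not_lt.2 h'.le] at hne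
    · exact ⟨div_pos_of_neg_of_neg h (by linarith), div_pos_of_neg_of_neg (by linarith) (by linarith),
        by linarith⟩
    · exact ⟨div_pos h (by linarith), div_pos (by linarith) (by linarith), by linarith⟩
    · rw [if_pos h, if_pos h'] at hne; exact absurd rfl hne
  obtain ⟨p1, p2, p3⟩ := aux _ _ h1 h2 e1
  obtain ⟨r1, r2, r3⟩ := aux _ _ h3 h4 e2
  refine ⟨(-dt c d b / (dt c d a - dt c d b)) • a + (dt c d a / (dt c d a - dt c d b)) • b,
    ⟨_, _, r2.le, r1.le, ?_, rfl⟩, ⟨-dt a b d / (dt a b c - dt a b d), dt a b c / (dt a b c - dt a b d), p2.le, p1.le, ?_, ?_⟩⟩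
  · field_simp; ring
  · field_simp; ring
  · have hh : dt c d a - dt c d b = -(dt a b c - dt a b d) := by unfold dt; ring
    rw [hh]
    have p3' : -(dt a b c - dt a b d) ≠ 0 := neg_ne_zero.2 p3
    ext
    · simp only [Prod.fst_add, Prod.smul_fst, smul_eq_mul]
      field_simp
      unfold dt; ring
    · simp only [Prod.snd_add, Prod.smul_snd, smul_eq_mul]
      field_simp
      unfold dt; ring

open Finset in
/-- parity of crossings of two polygonal paths -/
noncomputable def cr {ι : Type*} (q : ι → ℝ × ℝ) (a : ℕ → ι) (n : ℕ) (c : ℕ → ι) (m : ℕ) : ZMod 2 :=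
  ∑ s ∈ range n, ∑ t ∈ range m, cx (q (a s)) (q (a (s+1))) (q (c t)) (q (c (t+1)))

open Finset in
/-- winding parity -/
noncomputable def wd {ι : Type*} (q : ι → ℝ × ℝ) (a : ℕ → ι) (n : ℕ) (x : ι) : ZMod 2 :=
  ∑ s ∈ range n, inn (q (a 0)) (q (a (s+1))) (q (a (s+2))) (q x)

open Finset in
lemma tele_seg {ι : Type*} {q : ι → ℝ × ℝ} (hq : GP q) (a : ℕ → ι) (n : ℕ) (c d : ι) (cd : c ≠ d)
    (hinj : ∀ s ≤ n + 1, ∀ t ≤ n + 1, a s = a t → s = t)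
    (hac : ∀ s ≤ n + 1, a s ≠ c) (had : ∀ s ≤ n + 1, a s ≠ d) :
    ∑ s ∈ range (n+1), cx (q (a s)) (q (a (s+1))) (q c) (q d) =
      cx (q (a 0)) (q (a (n+1))) (q c) (q d) + (wd q a n c + wd q a n d) := by
  induction n with
  | zero => simp [wd]
  | succ n ih =>
    rw [sum_range_succ, ih (fun s hs t ht => hinj s (by omega) t (by omega))
      (fun s hs => hac s (by omega)) (fun s hs => had s (by omega))]
    have ne : ∀ s ≤ n + 2, ∀ t ≤ n + 2, s ≠ t → a s ≠ a t := fun s hs t ht h h' =>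
      h (hinj s (by omega) t (by omega) h')
    have key := tri_gp hq (a := a 0) (b := a (n+1)) (c := a (n+2)) (d := c) (e := d)
      (ne _ (by omega) _ (by omega) (by omega)) (ne _ (by omega) _ (by omega) (by omega))
      (hac _ (by omega)) (had _ (by omega)) (ne _ (by omega) _ (by omega) (by omega))
      (hac _ (by omega)) (had _ (by omega)) (hac _ (by omega)) (had _ (by omega)) cd
    have e1 : ∀ x, wd q a (n+1) x = wd q a n x + inn (q (a 0)) (q (a (n+1))) (q (a (n+2))) (q x) := by
      intro x; unfold wd; rw [sum_range_succ]
    rw [e1, e1]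
    have two : (2 : ZMod 2) = 0 := rfl
    rw [show n + 1 + 1 = n + 2 from rfl]
    linear_combination key - cx (q (a 0)) (q (a (n+2))) (q c) (q d) * two

open Finset in
lemma tele_path {ι : Type*} {q : ι → ℝ × ℝ} (hq : GP q) (a : ℕ → ι) (n : ℕ) (c : ℕ → ι) (m : ℕ)
    (hinj : ∀ s ≤ n + 1, ∀ t ≤ n + 1, a s = a t → s = t)
    (hinj' : ∀ s ≤ m, ∀ t ≤ m, c s = c t → s = t)
    (hac : ∀ s ≤ n + 1, ∀ t ≤ m, a s ≠ c t) :
    cr q a (n+1) c m =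
      ∑ t ∈ range m, cx (q (a 0)) (q (a (n+1))) (q (c t)) (q (c (t+1))) +
       (wd q a n (c 0) + wd q a n (c m)) := by
  unfold cr
  rw [sum_comm]
  have : ∀ t ∈ range m, ∑ s ∈ range (n+1), cx (q (a s)) (q (a (s+1))) (q (c t)) (q (c (t+1))) =
      cx (q (a 0)) (q (a (n+1))) (q (c t)) (q (c (t+1))) + (wd q a n (c (t+1)) - wd q a n (c t)) := by
    intro t ht
    have ht' := mem_range.1 ht
    rw [tele_seg hq a n (c t) (c (t+1)) (fun h => by have := hinj' t (by omega) (t+1) (by omega) h; omega)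
      hinj (fun s hs => hac s hs t (by omega)) (fun s hs => hac s hs (t+1) (by omega))]
    have two : (2 : ZMod 2) = 0 := rfl
    linear_combination wd q a n (c t) * two
  rw [sum_congr rfl this, sum_add_distrib, sum_range_sub (fun t => wd q a n (c t))]
  have two : (2 : ZMod 2) = 0 := rfl
  linear_combination - wd q a n (c 0) * two

open Finset in
lemma tele_full {ι : Type*} {q : ι → ℝ × ℝ} (hq : GP q) (a : ℕ → ι) (n : ℕ) (c : ℕ → ι)
    (hinj : ∀ s ≤ n + 1, ∀ t ≤ n + 1, a s = a t → s = t)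
    (hinj' : ∀ s ≤ n + 1, ∀ t ≤ n + 1, c s = c t → s = t)
    (hac : ∀ s ≤ n + 1, ∀ t ≤ n + 1, a s ≠ c t) :
    cr q a (n+1) c (n+1) =
      cx (q (a 0)) (q (a (n+1))) (q (c 0)) (q (c (n+1))) +
       (wd q a n (c 0) + wd q a n (c (n+1))) + (wd q c n (a 0) + wd q c n (a (n+1))) := by
  rw [tele_path hq a n c (n+1) hinj hinj' hac]
  have := tele_seg hq c n (a 0) (a (n+1)) (fun h => by have := hinj 0 (by omega) (n+1) (by omega) h; omega)
    hinj' (fun s hs => (hac 0 (by omega) s hs).symm) (fun s hs => (hac (n+1) (by omega) s hs).symm)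
  simp_rw [cx_symm (q (a 0))]
  rw [this]
  ring

end PS

namespace PS

lemma exists_gp {ι : Type*} [Finite ι] (q : ι → ℝ × ℝ) {δ : ℝ} (hδ : 0 < δ) :
    ∃ q' : ι → ℝ × ℝ, GP q' ∧ ∀ i, dist (q' i) (q i) < δ := by
  obtain ⟨n, ⟨em⟩⟩ := Finite.exists_equiv_fin ι
  set e : ι → ℝ := fun i => ((em i : ℕ) : ℝ) with he
  have hinj : ∀ i j, i ≠ j → e i ≠ e j := by
    intro i j h h'
    apply h
    have : ((em i : ℕ)) = (em j : ℕ) := by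
      simp only [he] at h'
      exact Nat.cast_injective h'
    exact em.injective (Fin.ext this)
  set Q : ℝ → ι → ℝ × ℝ := fun t i => ((q i).1 + t * e i, (q i).2 + t * (e i)^2) with hQ
  have hfin : ∀ i j k, i ≠ j → i ≠ k → j ≠ k → {t : ℝ | dt (Q t i) (Q t j) (Q t k) = 0}.Finite := by
    intro i j k hij hik hjk
    set A : ℝ := (e j - e i) * ((e k)^2 - (e i)^2) - ((e j)^2 - (e i)^2) * (e k - e i) with hA
    have hA0 : A ≠ 0 := by
      have : A = (e j - e i) * (e k - e i) * (e k - e j) := by rw [hA]; ring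
      rw [this]
      exact mul_ne_zero (mul_ne_zero (sub_ne_zero.2 (hinj _ _ hij.symm)) (sub_ne_zero.2 (hinj _ _ hik.symm)))
        (sub_ne_zero.2 (hinj _ _ hjk.symm))
    set B : ℝ := ((q j).1 - (q i).1) * ((e k)^2 - (e i)^2) + (e j - e i) * ((q k).2 - (q i).2)
      - ((q j).2 - (q i).2) * (e k - e i) - ((e j)^2 - (e i)^2) * ((q k).1 - (q i).1) with hB
    set D : ℝ := dt (q i) (q j) (q k) with hD
    set p : Polynomial ℝ := Polynomial.C A * Polynomial.X ^ 2 + Polynomial.C B * Polynomial.X + Polynomial.C D with hp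
    have hp0 : p ≠ 0 := by
      intro h0
      have := congrArg (fun r => Polynomial.coeff r 2) h0
      simp [hp, Polynomial.coeff_X, Polynomial.coeff_C] at this
      exact hA0 this
    apply (p.roots.toFinset.finite_toSet).subset
    intro t ht
    simp only [Set.mem_ofPred_eq] at ht
    simp only [Finset.mem_coe, Multiset.mem_toFinset, Polynomial.mem_roots hp0, Polynomial.IsRoot]
    rw [← ht]
    simp only [hp, Polynomial.eval_add, Polynomial.eval_mul, Polynomial.eval_C, Polynomial.eval_pow, Polynomial.eval_X]
    simp only [hA, hB, hD, hQ, dt]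
    ring
  set bad : Set ℝ := ⋃ i, ⋃ j, ⋃ k, {t : ℝ | (i ≠ j ∧ i ≠ k ∧ j ≠ k) ∧ dt (Q t i) (Q t j) (Q t k) = 0} with hbad
  have hbadfin : bad.Finite := by
    refine Set.finite_iUnion fun i => Set.finite_iUnion fun j => Set.finite_iUnion fun k => ?_
    by_cases h : i ≠ j ∧ i ≠ k ∧ j ≠ k
    · exact (hfin i j k h.1 h.2.1 h.2.2).subset fun t ht => ht.2
    · convert Set.finite_empty
      ext t; simp only [Set.mem_ofPred_eq, Set.mem_empty_iff_false, iff_false]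
      exact fun ht => h ht.1
  set M : ℝ := (n : ℝ) + 1 with hM
  have hMpos : 0 < M := by positivity
  have heM : ∀ i, 0 ≤ e i ∧ e i ≤ M := by
    intro i
    refine ⟨by positivity, ?_⟩
    have : ((em i : ℕ) : ℝ) ≤ n := by exact_mod_cast (em i).2.le
    simp only [he, hM]; linarith
  have hM1 : 1 ≤ M := by rw [hM]; linarith [Nat.cast_nonneg (α := ℝ) n]
  have hinf : (Set.Ioo (0:ℝ) (δ / M^2)).Infinite := Set.Ioo_infinite (by positivity)
  obtain ⟨t, ht, htb⟩ := hinf.exists_notMem_finite hbadfin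
  refine ⟨Q t, ?_, ?_⟩
  · intro i j k hij hik hjk h0
    apply htb
    simp only [hbad, Set.mem_iUnion]
    exact ⟨i, j, k, ⟨hij, hik, hjk⟩, h0⟩
  · intro i
    have h2 : t * M^2 < δ := by
      have := ht.2
      rwa [lt_div_iff₀ (by positivity)] at this
    have h0 := (heM i).1
    have h1 := (heM i).2
    have h3 : e i ≤ M^2 := by nlinarith
    have h4 : (e i)^2 ≤ M^2 := by nlinarith
    have ht0 := ht.1
    rw [Prod.dist_eq, max_lt_iff, Real.dist_eq, Real.dist_eq]
    simp only [hQ, add_sub_cancel_left]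
    rw [abs_of_nonneg (by positivity), abs_of_nonneg (by positivity)]
    constructor <;> nlinarith

/-- index of the t-th vertex of the polygonal path from i to j -/
def idx (n : ℕ) (i j : Fin 5) (t : ℕ) : Fin 5 ⊕ (Fin 5 × Fin 5 × Fin (n+1)) :=
  if t = 0 then Sum.inl i else if h : t < n + 1 then Sum.inr (i, j, ⟨t, h⟩) else Sum.inl j

lemma idx_inj {n : ℕ} {i j : Fin 5} (hij : i ≠ j) : ∀ s ≤ n + 1, ∀ t ≤ n + 1,
    idx n i j s = idx n i j t → s = t := by
  intro s hs t ht h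
  unfold idx at h
  split_ifs at h <;> simp_all <;> omega

lemma idx_ne {n : ℕ} {i j k l : Fin 5} (hik : i ≠ k) (hil : i ≠ l) (hjk : j ≠ k) (hjl : j ≠ l)
    (s t : ℕ) : idx n i j s ≠ idx n k l t := by
  intro h
  unfold idx at h
  split_ifs at h <;> simp_all

lemma k5_comb (n : ℕ) (q : Fin 5 ⊕ (Fin 5 × Fin 5 × Fin (n+1)) → ℝ × ℝ) (hq : GP q) :
    ∃ i j k l : Fin 5, i < j ∧ k < l ∧ i ≠ k ∧ i ≠ l ∧ j ≠ k ∧ j ≠ l ∧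
      cr q (idx n i j) (n+1) (idx n k l) (n+1) ≠ 0 := by
  by_contra! hcon
  set W : Fin 5 → Fin 5 → Fin 5 → ZMod 2 := fun i j x => wd q (idx n i j) n (Sum.inl x) with hW
  have H : ∀ i j k l : Fin 5, i < j → k < l → i ≠ k → i ≠ l → j ≠ k → j ≠ l →
      cx (q (Sum.inl i)) (q (Sum.inl j)) (q (Sum.inl k)) (q (Sum.inl l)) +
        (W i j k + W i j l) + (W k l i + W k l j) = 0 := by
    intro i j k l hij hkl hik hil hjk hjl
    have h1 := tele_full hq (idx n i j) n (idx n k l) (idx_inj hij.ne) (idx_inj hkl.ne)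
      (fun s _ t _ => idx_ne hik hil hjk hjl s t)
    rw [hcon i j k l hij hkl hik hil hjk hjl] at h1
    have e0 : ∀ a b, idx n a b 0 = Sum.inl a := fun a b => by simp [idx]
    have e1 : ∀ a b, idx n a b (n+1) = Sum.inl b := fun a b => by simp [idx]
    simp only [e0, e1] at h1
    exact h1.symm
  have key := k5_gp hq (a := Sum.inl 0) (b := Sum.inl 1) (c := Sum.inl 2) (d := Sum.inl 3) (e := Sum.inl 4)
    (by simp) (by simp) (by simp) (by simp) (by simp) (by simp) (by simp) (by simp) (by simp) (by simp)
  have h0123 := H 0 1 2 3 (by decide) (by decide) (by decide) (by decide) (by decide) (by decide)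
  have h0213 := H 0 2 1 3 (by decide) (by decide) (by decide) (by decide) (by decide) (by decide)
  have h0312 := H 0 3 1 2 (by decide) (by decide) (by decide) (by decide) (by decide) (by decide)
  have h0124 := H 0 1 2 4 (by decide) (by decide) (by decide) (by decide) (by decide) (by decide)
  have h0214 := H 0 2 1 4 (by decide) (by decide) (by decide) (by decide) (by decide) (by decide)
  have h0412 := H 0 4 1 2 (by decide) (by decide) (by decide) (by decide) (by decide) (by decide)
  have h0134 := H 0 1 3 4 (by decide) (by decide) (by decide) (by decide) (by decide) (by decide)
  have h0314 := H 0 3 1 4 (by decide) (by decide) (by decide) (by decide) (by decide) (by decide)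
  have h0413 := H 0 4 1 3 (by decide) (by decide) (by decide) (by decide) (by decide) (by decide)
  have h0234 := H 0 2 3 4 (by decide) (by decide) (by decide) (by decide) (by decide) (by decide)
  have h0324 := H 0 3 2 4 (by decide) (by decide) (by decide) (by decide) (by decide) (by decide)
  have h0423 := H 0 4 2 3 (by decide) (by decide) (by decide) (by decide) (by decide) (by decide)
  have h1234 := H 1 2 3 4 (by decide) (by decide) (by decide) (by decide) (by decide) (by decide)
  have h1324 := H 1 3 2 4 (by decide) (by decide) (by decide) (by decide) (by decide) (by decide)
  have h1423 := H 1 4 2 3 (by decide) (by decide) (by decide) (by decide) (by decide) (by decide)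
  have two : (2 : ZMod 2) = 0 := rfl
  have : (1 : ZMod 2) = 0 := by
    linear_combination h0123 + h0213 + h0312 + h0124 + h0214 + h0412 + h0134 + h0314 + h0413 + h0234 + h0324 + h0423 + h1234 + h1324 + h1423 - key - (W 0 1 2 + W 0 1 3 + W 0 1 4 + W 0 2 1 + W 0 2 3 + W 0 2 4 + W 0 3 1 + W 0 3 2 + W 0 3 4 + W 0 4 1 + W 0 4 2 + W 0 4 3 + W 1 2 0 + W 1 2 3 + W 1 2 4 + W 1 3 0 + W 1 3 2 + W 1 3 4 + W 1 4 0 + W 1 4 2 + W 1 4 3 + W 2 3 0 + W 2 3 1 + W 2 3 4 + W 2 4 0 + W 2 4 1 + W 2 4 3 + W 3 4 0 + W 3 4 1 + W 3 4 2) * two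
  exact absurd this (by decide)

lemma exists_delta (K : Fin 5 → Fin 5 → Set (ℝ × ℝ)) (hK : ∀ i j, IsCompact (K i j))
    (hd : ∀ i j k l : Fin 5, i < j → k < l → i ≠ k → i ≠ l → j ≠ k → j ≠ l → Disjoint (K i j) (K k l)) :
    ∃ δ > 0, ∀ i j k l : Fin 5, i < j → k < l → i ≠ k → i ≠ l → j ≠ k → j ≠ l →
      Disjoint (Metric.thickening δ (K i j)) (Metric.thickening δ (K k l)) := by
  have : ∀ x : Fin 5 × Fin 5 × Fin 5 × Fin 5, ∃ δ > 0, (x.1 < x.2.1 → x.2.2.1 < x.2.2.2 → x.1 ≠ x.2.2.1 →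
      x.1 ≠ x.2.2.2 → x.2.1 ≠ x.2.2.1 → x.2.1 ≠ x.2.2.2 →
      Disjoint (Metric.thickening δ (K x.1 x.2.1)) (Metric.thickening δ (K x.2.2.1 x.2.2.2))) := by
    rintro ⟨i, j, k, l⟩
    by_cases h : Disjoint (K i j) (K k l)
    · obtain ⟨δ, h0, h1⟩ := h.exists_thickenings (hK i j) (hK k l).isClosed
      exact ⟨δ, h0, fun _ _ _ _ _ _ => h1⟩
    · exact ⟨1, one_pos, fun a b c d e f => absurd (hd i j k l a b c d e f) h⟩
  choose δ h0 h1 using this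
  obtain ⟨x0, hx0⟩ := Finite.exists_min δ
  refine ⟨δ x0, h0 x0, fun i j k l a b c d e f => ?_⟩
  have := h1 (i, j, k, l) a b c d e f
  exact this.mono (Metric.thickening_mono (hx0 _) _) (Metric.thickening_mono (hx0 _) _)

/-- van Kampen–Flores for K5 -/
theorem k5_top (v : Fin 5 → ℝ × ℝ) (K : Fin 5 → Fin 5 → Set (ℝ × ℝ))
    (hK : ∀ i j, i < j → JoinedIn (K i j) (v i) (v j)) :
    ∃ i j k l : Fin 5, i < j ∧ k < l ∧ i ≠ k ∧ i ≠ l ∧ j ≠ k ∧ j ≠ l ∧ (K i j ∩ K k l).Nonempty := by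
  by_contra! hcon
  have hg : ∀ i j : Fin 5, ∃ g : unitInterval → ℝ × ℝ, Continuous g ∧ (i < j → (g 0 = v i ∧ g 1 = v j ∧
      ∀ t, g t ∈ K i j)) := by
    intro i j
    by_cases h : i < j
    · obtain ⟨γ, hγ⟩ := hK i j h
      exact ⟨γ, γ.continuous, fun _ => ⟨γ.source, γ.target, hγ⟩⟩
    · exact ⟨fun _ => 0, continuous_const, fun h' => absurd h' h⟩
  choose g gc gK using hg
  obtain ⟨δ, hδ, hdis⟩ := exists_delta (fun i j => Set.range (g i j)) (fun i j => isCompact_range (gc i j))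
    (by
      intro i j k l a b c d e f
      rw [Set.disjoint_left]
      rintro x ⟨s, rfl⟩ ⟨t, ht⟩
      have h1 := (gK i j a).2.2 s
      have h2 := (gK k l b).2.2 t
      rw [ht] at h2
      have := hcon i j k l a b c d e f
      exact (Set.eq_empty_iff_forall_notMem.1 this) _ ⟨h1, h2⟩)
  have hU : ∃ η > 0, ∀ i j, ∀ s t : unitInterval, dist s t < η → dist (g i j s) (g i j t) < δ / 2 := by
    have : ∀ x : Fin 5 × Fin 5, ∃ η > 0, ∀ s t : unitInterval, dist s t < η →
        dist (g x.1 x.2 s) (g x.1 x.2 t) < δ / 2 := by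
      intro x
      have uc := CompactSpace.uniformContinuous_of_continuous (gc x.1 x.2)
      obtain ⟨η, h0, h1⟩ := Metric.uniformContinuous_iff.1 uc (δ/2) (by positivity)
      exact ⟨η, h0, fun s t h => h1 h⟩
    choose η h0 h1 using this
    obtain ⟨x0, hx0⟩ := Finite.exists_min η
    exact ⟨η x0, h0 x0, fun i j s t h => h1 (i, j) s t (lt_of_lt_of_le h (hx0 _))⟩
  obtain ⟨η, hη, hU⟩ := hU
  obtain ⟨n, hn⟩ := exists_nat_one_div_lt hη
  set τ : ℕ → unitInterval := fun t => Set.projIcc 0 1 zero_le_one ((t : ℝ) / (n + 1)) with hτ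
  have hτd : ∀ t, dist (τ (t+1)) (τ t) < η := by
    intro t
    refine lt_of_le_of_lt ?_ hn
    rw [Subtype.dist_eq, Real.dist_eq]
    refine le_trans (Set.abs_projIcc_sub_projIcc zero_le_one) ?_
    rw [← sub_div, abs_div, abs_of_pos (by positivity : (0:ℝ) < n + 1)]
    simp
  have hτ0 : τ 0 = 0 := by simp [hτ]
  have hτ1 : τ (n+1) = 1 := by
    simp only [hτ]
    have : ((n + 1 : ℕ) : ℝ) / (n + 1) = 1 := by push_cast; field_simp
    rw [this]; simp
  set q0 : Fin 5 ⊕ (Fin 5 × Fin 5 × Fin (n+1)) → ℝ × ℝ := fun x => match x with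
    | Sum.inl i => v i
    | Sum.inr (i, j, t) => g i j (τ t) with hq0
  have hq0i : ∀ i j, i < j → ∀ t ≤ n + 1, q0 (idx n i j t) = g i j (τ t) := by
    intro i j hij t ht
    unfold idx
    split_ifs with h1 h2
    · rw [h1, hτ0, (gK i j hij).1]
    · rfl
    · have : t = n + 1 := by omega
      rw [this, hτ1, (gK i j hij).2.1]
  obtain ⟨q, hq, hqd⟩ := exists_gp q0 (half_pos hδ)
  obtain ⟨i, j, k, l, a, b, c, d, e, f, hne⟩ := k5_comb n q hq
  apply hne
  unfold cr
  refine Finset.sum_eq_zero fun s hs => Finset.sum_eq_zero fun t ht => ?_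
  rw [Finset.mem_range] at hs ht
  by_contra hcx
  have seg : ∀ i j : Fin 5, i < j → ∀ t < n + 1, segment ℝ (q (idx n i j t)) (q (idx n i j (t+1))) ⊆
      Metric.thickening δ (Set.range (g i j)) := by
    intro i j hij t ht
    have h1 : q (idx n i j t) ∈ Metric.ball (g i j (τ t)) δ := by
      have := hqd (idx n i j t)
      rw [hq0i i j hij t (by omega)] at this
      rw [Metric.mem_ball]; linarith
    have h2 : q (idx n i j (t+1)) ∈ Metric.ball (g i j (τ t)) δ := by
      have := hqd (idx n i j (t+1))
      rw [hq0i i j hij (t+1) (by omega)] at this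
      have h3 := hU i j _ _ (hτd t)
      rw [Metric.mem_ball]
      have := dist_triangle (q (idx n i j (t+1))) (g i j (τ (t+1))) (g i j (τ t))
      linarith
    intro x hx
    have := (convex_ball (g i j (τ t)) δ).segment_subset h1 h2 hx
    rw [Metric.mem_thickening_iff]
    exact ⟨_, ⟨_, rfl⟩, this⟩
  have nij := idx_inj (n := n) a.ne
  have nkl := idx_inj (n := n) b.ne
  have n1 : idx n i j s ≠ idx n i j (s+1) := fun h => by have := nij s (by omega) (s+1) (by omega) h; omega
  have n2 : idx n k l t ≠ idx n k l (t+1) := fun h => by have := nkl t (by omega) (t+1) (by omega) h; omega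
  have n3 := fun s t => idx_ne (n := n) c d e f s t
  obtain ⟨x, hx1, hx2⟩ := cx_seg (hq _ _ _ n1 (n3 _ _) (n3 _ _)) (hq _ _ _ n1 (n3 _ _) (n3 _ _))
    (hq _ _ _ n2 (n3 _ _).symm (n3 _ _).symm) (hq _ _ _ n2 (n3 _ _).symm (n3 _ _).symm) hcx
  exact Set.disjoint_left.1 (hdis i j k l a b c d e f) (seg i j a s hs hx1) (seg k l b t ht hx2)

end PS

namespace PS

open Relation Finset

/-- connectedness of a finite vertex set -/
def Conn {V : Type*} (R : V → V → Prop) (B : Finset V) : Prop :=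
  ∀ a ∈ B, ∀ b ∈ B, ReflTransGen (fun x y => R x y ∧ x ∈ B ∧ y ∈ B) a b

/-- a K_r minor model inside S -/
def HasK {V : Type*} (R : V → V → Prop) (S : Finset V) (r : ℕ) : Prop :=
  ∃ B : Fin r → Finset V, (∀ i, B i ⊆ S) ∧ (∀ i, (B i).Nonempty) ∧
    (∀ i j, i ≠ j → Disjoint (B i) (B j)) ∧ (∀ i, Conn R (B i)) ∧
    ∀ i j, i ≠ j → ∃ x ∈ B i, ∃ y ∈ B j, R x y

/-- number of ordered adjacent pairs -/
noncomputable def NE {V : Type*} (R : V → V → Prop) (S : Finset V) : ℕ :=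
  ((S ×ˢ S).filter (fun p => R p.1 p.2)).card

/-- contraction of v into u -/
def ctr {V : Type*} (R : V → V → Prop) (u v : V) (x y : V) : Prop :=
  x ≠ y ∧ (R x y ∨ (x = u ∧ R v y) ∨ (y = u ∧ R v x))

lemma ctr_count {V : Type*} (R : V → V → Prop) (hs : ∀ x y, R x y → R y x) (hi : ∀ x, ¬ R x x)
    (S : Finset V) (u v : V) (hu : u ∈ S) (huv : R u v) :
    NE R S ≤ NE (ctr R u v) (S.erase v) + 2 * (1 + (S.filter (fun w => R u w ∧ R v w)).card) := by
  set T := S.filter (fun w => R u w ∧ R v w) with hT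
  have huv' : u ≠ v := fun h => hi v (h ▸ huv)
  set A := (S ×ˢ S).filter (fun p => R p.1 p.2) with hA
  set X : Finset (V × V) := insert (u, v) (T.image (fun w => (v, w))) ∪
    insert (v, u) (T.image (fun w => (w, v))) with hX
  have hXc : X.card ≤ 2 * (1 + T.card) := by
    refine (card_union_le _ _).trans ?_
    have h1 := (card_insert_le (u, v) (T.image (fun w => (v, w))))
    have h2 := (card_insert_le (v, u) (T.image (fun w => (w, v))))
    have h3 : (T.image (fun w => (v, w))).card ≤ T.card := card_image_le
    have h4 : (T.image (fun w => (w, v))).card ≤ T.card := card_image_le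
    omega
  have hsd : A.card ≤ (A \ X).card + X.card := by
    have := Finset.le_card_sdiff X A
    omega
  have hinj : (A \ X).card ≤ NE (ctr R u v) (S.erase v) := by
    unfold NE
    let f : V → V := fun x => if x = v then u else x
    apply card_le_card_of_injOn (fun p => (f p.1, f p.2))
    · rintro ⟨x, y⟩ hxy
      simp only [coe_sdiff, Set.mem_sdiff, mem_coe, hA, hX, mem_filter, mem_product, mem_union, mem_insert,
        mem_image, not_or, hT] at hxy
      obtain ⟨⟨⟨hx, hy⟩, hR⟩, ⟨h1, h2⟩, h3, h4⟩ := hxy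
      simp only [coe_filter, mem_product, mem_erase, Set.mem_ofPred_eq]
      have hvu := hs _ _ huv
      by_cases ex : x = v
      · subst ex
        have ey : y ≠ x := fun h => hi x (by rw [h] at hR; exact hR)
        have ey' : y ≠ u := fun h => h3 (by rw [h])
        simp only [f, if_true, if_neg ey]
        exact ⟨⟨⟨huv', hu⟩, ey, hy⟩, ey'.symm, Or.inr (Or.inl ⟨rfl, hR⟩)⟩
      · by_cases ey : y = v
        · subst ey
          have ex' : x ≠ u := fun h => h1 (by rw [h])
          simp only [f, if_true, if_neg ex]
          exact ⟨⟨⟨ex, hx⟩, huv', hu⟩, ex', Or.inr (Or.inr ⟨rfl, hs _ _ hR⟩)⟩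
        · simp only [f, if_neg ex, if_neg ey]
          exact ⟨⟨⟨ex, hx⟩, ey, hy⟩, fun h => hi x (by rw [← h] at hR; exact hR), Or.inl hR⟩
    · rintro ⟨x, y⟩ hxy ⟨x', y'⟩ hxy' heq
      simp only [coe_sdiff, Set.mem_sdiff, mem_coe, hA, hX, mem_filter, mem_product, mem_union, mem_insert,
        mem_image, not_or, hT, not_exists, not_and] at hxy hxy'
      obtain ⟨⟨⟨hx, hy⟩, hR⟩, ⟨h1, h2⟩, h3, h4⟩ := hxy
      obtain ⟨⟨⟨hx', hy'⟩, hR'⟩, ⟨h1', h2'⟩, h3', h4'⟩ := hxy'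
      simp only [Prod.mk.injEq, f] at heq h1 h2 h3 h4 h1' h2' h3' h4' ⊢
      obtain ⟨e1, e2⟩ := heq
      split_ifs at e1 e2 <;> grind
  have : NE R S = A.card := rfl
  omega

lemma ctr_pull {V : Type*} (R : V → V → Prop) (hs : ∀ x y, R x y → R y x)
    (S : Finset V) (u v : V) (hv : v ∈ S) (huv : R u v) (r : ℕ)
    (h : HasK (ctr R u v) (S.erase v) r) : HasK R S r := by
  obtain ⟨B, h1, h2, h3, h4, h5⟩ := h
  have hvB : ∀ i, v ∉ B i := fun i hi => by have := h1 i hi; simp at this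
  refine ⟨fun i => if u ∈ B i then insert v (B i) else B i, ?_, ?_, ?_, ?_, ?_⟩
  · intro i x hx
    dsimp only at hx
    split_ifs at hx
    · rcases mem_insert.1 hx with rfl | hx
      · exact hv
      · exact (mem_erase.1 (h1 i hx)).2
    · exact (mem_erase.1 (h1 i hx)).2
  · intro i
    obtain ⟨x, hx⟩ := h2 i
    refine ⟨x, ?_⟩
    dsimp only
    split_ifs
    · exact mem_insert_of_mem hx
    · exact hx
  · intro i j hij
    have hd := h3 i j hij
    dsimp only
    split_ifs with hui huj huj
    · exact absurd (disjoint_left.1 hd hui huj) (by simp)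
    · rw [disjoint_insert_left]; exact ⟨hvB j, hd⟩
    · rw [disjoint_insert_right]; exact ⟨hvB i, hd⟩
    · exact hd
  · intro i
    dsimp only
    split_ifs with hui
    · have step : ∀ x y, (ctr R u v x y ∧ x ∈ B i ∧ y ∈ B i) →
          ReflTransGen (fun x y => R x y ∧ x ∈ insert v (B i) ∧ y ∈ insert v (B i)) x y := by
        rintro x y ⟨⟨hne, hc⟩, hx, hy⟩
        have hx' := mem_insert_of_mem (b := v) hx
        have hy' := mem_insert_of_mem (b := v) hy
        have hv' := mem_insert_self v (B i)
        rcases hc with hc | ⟨rfl, hc⟩ | ⟨rfl, hc⟩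
        · exact ReflTransGen.single ⟨hc, hx', hy'⟩
        · exact ReflTransGen.head ⟨huv, hx', hv'⟩ (ReflTransGen.single ⟨hc, hv', hy'⟩)
        · exact ReflTransGen.head ⟨hs _ _ hc, hx', hv'⟩ (ReflTransGen.single ⟨hs _ _ huv, hv', hy'⟩)
      have hu' := mem_insert_of_mem (b := v) hui
      have hv' := mem_insert_self v (B i)
      have from_u : ∀ x ∈ insert v (B i),
          ReflTransGen (fun x y => R x y ∧ x ∈ insert v (B i) ∧ y ∈ insert v (B i)) u x := by
        intro x hx
        rcases mem_insert.1 hx with rfl | hx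
        · exact ReflTransGen.single ⟨huv, hu', hv'⟩
        · exact ReflTransGen.lift' id step _ _ (h4 i u hui x hx)
      have to_u : ∀ x ∈ insert v (B i),
          ReflTransGen (fun x y => R x y ∧ x ∈ insert v (B i) ∧ y ∈ insert v (B i)) x u := by
        intro x hx
        rcases mem_insert.1 hx with rfl | hx
        · exact ReflTransGen.single ⟨hs _ _ huv, hv', hu'⟩
        · exact ReflTransGen.lift' id step _ _ (h4 i x hx u hui)
      exact fun a ha b hb => (to_u a ha).trans (from_u b hb)
    · intro a ha b hb
      refine ReflTransGen.mono ?_ _ _ (h4 i a ha b hb)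
      rintro x y ⟨⟨hne, hc⟩, hx, hy⟩
      refine ⟨?_, hx, hy⟩
      rcases hc with hc | ⟨rfl, hc⟩ | ⟨rfl, hc⟩
      · exact hc
      · exact absurd hx hui
      · exact absurd hy hui
  · intro i j hij
    obtain ⟨x, hx, y, hy, hne, hc⟩ := h5 i j hij
    have sub : ∀ i, B i ⊆ (if u ∈ B i then insert v (B i) else B i) := by
      intro i; split_ifs
      · exact subset_insert _ _
      · exact Subset.refl _
    rcases hc with hc | ⟨rfl, hc⟩ | ⟨rfl, hc⟩
    · exact ⟨x, sub i hx, y, sub j hy, hc⟩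
    · exact ⟨v, by simp [hx], y, sub j hy, hc⟩
    · exact ⟨x, sub i hx, v, by simp [hy], hs _ _ hc⟩

lemma minor_step {V : Type*} (r c : ℕ) (d : ℕ) (hc : 1 ≤ c) (hdc : d ≤ c)
    (ih : ∀ (R : V → V → Prop) (S : Finset V), (∀ x y, R x y → R y x) → (∀ x, ¬ R x x) → S.Nonempty →
      d * S.card ≤ NE R S → HasK R S r) :
    ∀ (n : ℕ) (R : V → V → Prop) (S : Finset V), S.card = n → (∀ x y, R x y → R y x) → (∀ x, ¬ R x x) →
      S.Nonempty → 2 * c * S.card ≤ NE R S → HasK R S (r+1) := by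
  intro n
  induction n with
  | zero =>
    intro R S h0 _ _ hne _
    rw [card_eq_zero] at h0
    exact absurd h0 hne.ne_empty
  | succ n ihn =>
    intro R S hcard hs hi hne hN
    by_cases hA : ∃ u ∈ S, ∃ v ∈ S, R u v ∧ (S.filter (fun w => R u w ∧ R v w)).card < c
    · obtain ⟨u, hu, v, hv, huv, ht⟩ := hA
      have huv' : u ≠ v := fun h => hi v (h ▸ huv)
      have hcnt := ctr_count R hs hi S u v hu huv
      apply ctr_pull R hs S u v hv huv
      have hce : (S.erase v).card = n := by rw [card_erase_of_mem hv, hcard]; rfl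
      apply ihn _ _ hce
      · rintro x y ⟨h1, h2⟩
        refine ⟨h1.symm, ?_⟩
        rcases h2 with h2 | h2 | h2
        · exact Or.inl (hs _ _ h2)
        · exact Or.inr (Or.inr h2)
        · exact Or.inr (Or.inl h2)
      · exact fun x h => h.1 rfl
      · exact ⟨u, mem_erase.2 ⟨huv', hu⟩⟩
      · rw [hce]
        rw [hcard] at hN
        have : 2 * c * (n+1) = 2 * c * n + 2 * c := by ring
        omega
    · push Not at hA
      have hpos : 0 < NE R S := by
        have : 0 < S.card := hne.card_pos
        have : 0 < 2 * c * S.card := by positivity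
        omega
      obtain ⟨⟨v, w⟩, hvw⟩ := card_pos.1 hpos
      simp only [mem_filter, mem_product] at hvw
      obtain ⟨⟨hv, hw⟩, hR⟩ := hvw
      set T := S.filter (fun w => R v w) with hT
      have hTN : d * T.card ≤ NE R T := by
        have hNE : ∀ T : Finset V, NE R T = ∑ x ∈ T, (T.filter (fun y => R x y)).card := by
          intro T
          unfold NE
          rw [card_filter, sum_product]
          exact sum_congr rfl (fun x _ => (card_filter _ _).symm)
        rw [hNE, mul_comm, ← smul_eq_mul]
        apply card_nsmul_le_sum
        intro x hx
        have hx' := mem_filter.1 hx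
        have := hA v hv x hx'.1 hx'.2
        rw [hT, filter_filter]
        omega
      obtain ⟨B, h1, h2, h3, h4, h5⟩ := ih R T hs hi ⟨w, mem_filter.2 ⟨hw, hR⟩⟩ hTN
      have hvB : ∀ i, v ∉ B i := fun i h => hi v (mem_filter.1 (h1 i h)).2
      refine ⟨Fin.cons {v} B, ?_, ?_, ?_, ?_, ?_⟩
      · intro i
        refine Fin.cases ?_ (fun i => ?_) i
        · simpa using hv
        · simpa using (h1 i).trans (filter_subset _ _)
      · intro i
        refine Fin.cases ?_ (fun i => ?_) i
        · simp
        · simpa using h2 i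
      · intro i j
        refine Fin.cases ?_ (fun i => ?_) i <;> refine Fin.cases ?_ (fun j => ?_) j
        · simp
        · intro _; simpa using hvB j
        · intro _; simpa using hvB i
        · intro hij
          simpa using h3 i j (fun h => hij (by rw [h]))
      · intro i
        refine Fin.cases ?_ (fun i => ?_) i
        · intro a ha b hb
          simp at ha hb
          subst ha; subst hb; exact ReflTransGen.refl
        · simpa using h4 i
      · intro i j
        refine Fin.cases ?_ (fun i => ?_) i <;> refine Fin.cases ?_ (fun j => ?_) j
        · simp
        · intro _
          obtain ⟨y, hy⟩ := h2 j
          exact ⟨v, by simp, y, by simpa using hy, (mem_filter.1 (h1 j hy)).2⟩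
        · intro _
          obtain ⟨y, hy⟩ := h2 i
          exact ⟨y, by simpa using hy, v, by simp, hs _ _ (mem_filter.1 (h1 i hy)).2⟩
        · intro hij
          simpa using h5 i j (fun h => hij (by rw [h]))

lemma k5_minor {V : Type*} (R : V → V → Prop) (S : Finset V) (hs : ∀ x y, R x y → R y x)
    (hi : ∀ x, ¬ R x x) (hne : S.Nonempty) (hN : 16 * S.card ≤ NE R S) : HasK R S 5 := by
  have m1 : ∀ (R : V → V → Prop) (S : Finset V), (∀ x y, R x y → R y x) → (∀ x, ¬ R x x) → S.Nonempty →
      0 * S.card ≤ NE R S → HasK R S 1 := by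
    intro R S _ _ hne _
    obtain ⟨x, hx⟩ := hne
    refine ⟨fun _ => {x}, by simpa using hx, by simp, ?_, ?_, ?_⟩
    · intro i j h; exact absurd (Subsingleton.elim i j) h
    · intro i a ha b hb
      simp at ha hb
      subst ha; subst hb; exact ReflTransGen.refl
    · intro i j h; exact absurd (Subsingleton.elim i j) h
  have m2 := fun R S => minor_step (V := V) 1 1 0 le_rfl (by norm_num) m1 _ R S rfl
  have m3 := fun R S => minor_step (V := V) 2 2 2 (by norm_num) (by norm_num) m2 _ R S rfl
  have m4 := fun R S => minor_step (V := V) 3 4 4 (by norm_num) (by norm_num) m3 _ R S rfl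
  have m5 := fun R S => minor_step (V := V) 4 8 8 (by norm_num) (by norm_num) m4 _ R S rfl
  exact m5 R S hs hi hne hN

end PS

namespace PS

open Relation Finset

/-- two edges are parallel -/
def Par {α : Type*} (a b : α → ℝ × ℝ) (e f : α) : Prop :=
  (a e = a f ∧ b e = b f) ∨ (a e = b f ∧ b e = a f)

/-- two edges share no vertex -/
def VDisj {α : Type*} (a b : α → ℝ × ℝ) (e f : α) : Prop :=
  a e ≠ a f ∧ a e ≠ b f ∧ b e ≠ a f ∧ b e ≠ b f

/-- two vertex disjoint edges whose arcs meet -/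
def Cross {α : Type*} (a b : α → ℝ × ℝ) (arc : α → Set (ℝ × ℝ)) (e f : α) : Prop :=
  VDisj a b e f ∧ (arc e ∩ arc f).Nonempty

lemma le_NE {V : Type*} (R : V → V → Prop) (S : Finset V) (X : Finset (V × V))
    (h : ∀ p ∈ X, p.1 ∈ S ∧ p.2 ∈ S ∧ R p.1 p.2) : X.card ≤ NE R S := by
  unfold NE
  apply card_le_card
  intro p hp
  obtain ⟨h1, h2, h3⟩ := h p hp
  exact mem_filter.2 ⟨mem_product.2 ⟨h1, h2⟩, h3⟩

lemma planar_bound {α : Type*} (E : Finset α) (V : Finset (ℝ × ℝ)) (a b : α → ℝ × ℝ)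
    (arc : α → Set (ℝ × ℝ)) (ha : ∀ e ∈ E, a e ∈ V) (hb : ∀ e ∈ E, b e ∈ V)
    (hab : ∀ e ∈ E, a e ≠ b e) (harc : ∀ e ∈ E, JoinedIn (arc e) (a e) (b e))
    (hpar : ∀ e ∈ E, ∀ f ∈ E, Par a b e f → e = f)
    (hcr : ∀ e ∈ E, ∀ f ∈ E, ¬ Cross a b arc e f) : E.card ≤ 8 * V.card := by
  by_contra! hlt
  have hEne : E.Nonempty := card_pos.1 (by omega)
  obtain ⟨e0, he0⟩ := hEne
  set R : ℝ × ℝ → ℝ × ℝ → Prop := fun x y => ∃ e ∈ E, (a e = x ∧ b e = y) ∨ (a e = y ∧ b e = x) with hR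
  have hs : ∀ x y, R x y → R y x := by
    rintro x y ⟨e, he, h⟩
    exact ⟨e, he, h.symm⟩
  have hi : ∀ x, ¬ R x x := by
    rintro x ⟨e, he, h⟩
    rcases h with ⟨h1, h2⟩ | ⟨h1, h2⟩ <;> exact hab e he (h1.trans h2.symm)
  have hNE : 2 * E.card ≤ NE R V := by
    have hd : Disjoint (E.image (fun e => (a e, b e))) (E.image (fun e => (b e, a e))) := by
      rw [disjoint_left]
      intro p hp hq
      obtain ⟨e, he, rfl⟩ := mem_image.1 hp
      obtain ⟨f, hf, h⟩ := mem_image.1 hq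
      simp only [Prod.mk.injEq] at h
      have := hpar e he f hf (Or.inr ⟨h.1.symm, h.2.symm⟩)
      subst this
      exact hab e he h.2
    have h1 : (E.image (fun e => (a e, b e))).card = E.card := by
      apply card_image_of_injOn
      intro e he f hf h
      simp only [Prod.mk.injEq] at h
      exact hpar e he f hf (Or.inl h)
    have h2 : (E.image (fun e => (b e, a e))).card = E.card := by
      apply card_image_of_injOn
      intro e he f hf h
      simp only [Prod.mk.injEq] at h
      exact hpar e he f hf (Or.inl h.symm)
    have h3 := card_union_of_disjoint hd
    rw [two_mul]
    rw [h1, h2] at h3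
    rw [← h3]
    apply le_NE
    intro p hp
    rcases mem_union.1 hp with hp | hp
    · obtain ⟨e, he, rfl⟩ := mem_image.1 hp
      exact ⟨ha e he, hb e he, e, he, Or.inl ⟨rfl, rfl⟩⟩
    · obtain ⟨e, he, rfl⟩ := mem_image.1 hp
      exact ⟨hb e he, ha e he, e, he, Or.inr ⟨rfl, rfl⟩⟩
  obtain ⟨B, h1, h2, h3, h4, h5⟩ := k5_minor R V hs hi ⟨a e0, ha e0 he0⟩ (by omega)
  choose v hv using h2
  set K : Fin 5 → Fin 5 → Set (ℝ × ℝ) := fun i j =>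
    {z | ∃ e ∈ E, (a e ∈ B i ∨ a e ∈ B j) ∧ (b e ∈ B i ∨ b e ∈ B j) ∧ z ∈ arc e} with hK
  have hedge : ∀ i j x y, (x ∈ B i ∨ x ∈ B j) → (y ∈ B i ∨ y ∈ B j) → R x y →
      JoinedIn (K i j) x y := by
    rintro i j x y hx hy ⟨e, he, h⟩
    rcases h with ⟨rfl, rfl⟩ | ⟨rfl, rfl⟩
    · exact (harc e he).mono (fun z hz => show z ∈ K i j from ⟨e, he, hx, hy, hz⟩)
    · exact ((harc e he).mono (fun z hz => show z ∈ K i j from ⟨e, he, hy, hx, hz⟩)).symm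
  have hconn : ∀ i j l, (l = i ∨ l = j) → ∀ x y,
      ReflTransGen (fun x y => R x y ∧ x ∈ B l ∧ y ∈ B l) x y → x ∈ K i j → JoinedIn (K i j) x y := by
    intro i j l hl x y h hx
    induction h with
    | refl => exact JoinedIn.refl hx
    | tail _ hbc ih =>
      refine ih.trans (hedge i j _ _ ?_ ?_ hbc.1)
      · rcases hl with rfl | rfl
        · exact Or.inl hbc.2.1
        · exact Or.inr hbc.2.1
      · rcases hl with rfl | rfl
        · exact Or.inl hbc.2.2
        · exact Or.inr hbc.2.2
  obtain ⟨i, j, k, l, hij, hkl, n1, n2, n3, n4, z, hz1, hz2⟩ := k5_top v K (by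
    intro i j hij
    obtain ⟨x, hx, y, hy, hxy⟩ := h5 i j hij.ne
    have e1 := hedge i j x y (Or.inl hx) (Or.inr hy) hxy
    have e2 := hconn i j i (Or.inl rfl) x (v i) (h4 i x hx _ (hv i)) e1.source_mem
    have e3 := hconn i j j (Or.inr rfl) y (v j) (h4 j y hy _ (hv j)) e1.target_mem
    exact e2.symm.trans (e1.trans e3))
  obtain ⟨e, he, e1, e2, e3⟩ := hz1
  obtain ⟨f, hf, f1, f2, f3⟩ := hz2
  have key : ∀ x y, (x ∈ B i ∨ x ∈ B j) → (y ∈ B k ∨ y ∈ B l) → x ≠ y := by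
    rintro x y hx hy rfl
    rcases hx with hx | hx <;> rcases hy with hy | hy
    · exact disjoint_left.1 (h3 i k n1) hx hy
    · exact disjoint_left.1 (h3 i l n2) hx hy
    · exact disjoint_left.1 (h3 j k n3) hx hy
    · exact disjoint_left.1 (h3 j l n4) hx hy
  exact hcr e he f hf ⟨⟨key _ _ e1 f1, key _ _ e1 f2, key _ _ e2 f1, key _ _ e2 f2⟩, z, e3, f3⟩

/-- ordered bad pairs -/
noncomputable def badPairs {α : Type*} (Q : α → α → Prop) (E : Finset α) : Finset (α × α) :=
  (E ×ˢ E).filter (fun p => Q p.1 p.2)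

lemma linear_bound {α : Type*} (V : Finset (ℝ × ℝ)) (a b : α → ℝ × ℝ)
    (arc : α → Set (ℝ × ℝ)) : ∀ (n : ℕ) (E : Finset α), E.card = n →
    (∀ e ∈ E, a e ∈ V) → (∀ e ∈ E, b e ∈ V) →
    (∀ e ∈ E, a e ≠ b e) → (∀ e ∈ E, JoinedIn (arc e) (a e) (b e)) →
    E.card ≤ 8 * V.card + (badPairs (Cross a b arc) E).card
      + (badPairs (fun e f => e ≠ f ∧ Par a b e f) E).card := by
  intro n
  induction n with
  | zero => intro E h; omega
  | succ n ih =>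
    intro E hE ha hb hab harc
    by_cases hbad : ∃ p ∈ E ×ˢ E, Cross a b arc p.1 p.2 ∨ (p.1 ≠ p.2 ∧ Par a b p.1 p.2)
    · obtain ⟨⟨e, f⟩, hp, hq⟩ := hbad
      obtain ⟨he, hf⟩ := mem_product.1 hp
      dsimp only at he hf hq
      have hsub : E.erase e ⊆ E := erase_subset _ _
      have hc : (E.erase e).card = n := by rw [card_erase_of_mem he, hE]; rfl
      have := ih (E.erase e) hc (fun x hx => ha x (hsub hx)) (fun x hx => hb x (hsub hx))
        (fun x hx => hab x (hsub hx)) (fun x hx => harc x (hsub hx))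
      have mono : ∀ Q : α → α → Prop, badPairs Q (E.erase e) ⊆ badPairs Q E := fun Q =>
        filter_subset_filter _ (product_subset_product hsub hsub)
      have strict : ∀ Q : α → α → Prop, Q e f → (badPairs Q (E.erase e)).card < (badPairs Q E).card := by
        intro Q hQ
        apply card_lt_card
        refine ⟨mono Q, fun h => ?_⟩
        have h1 : (e, f) ∈ badPairs Q E := mem_filter.2 ⟨hp, hQ⟩
        have h2 := h h1
        simp [badPairs] at h2
      have m1 := card_le_card (mono (Cross a b arc))
      have m2 := card_le_card (mono (fun e f => e ≠ f ∧ Par a b e f))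
      rcases hq with hq | hq
      · have := strict _ hq
        omega
      · have := strict (fun e f => e ≠ f ∧ Par a b e f) hq
        omega
    · push Not at hbad
      have := planar_bound E V a b arc ha hb hab harc
        (fun e he f hf h => by
          by_contra hne
          exact (hbad (e, f) (mem_product.2 ⟨he, hf⟩)).2 hne h)
        (fun e he f hf => (hbad (e, f) (mem_product.2 ⟨he, hf⟩)).1)
      omega

end PS

namespace PS

open Finset

/-- probability weight -/
noncomputable def wgt {ι : Type*} (Ω : Finset ι) (y : ι → ℝ) (S : Finset ι) : ℝ :=
  (∏ i ∈ S, y i) * ∏ i ∈ Ω \ S, (1 - y i)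

lemma wgt_sum {ι : Type*} (Ω : Finset ι) (y : ι → ℝ) (T : Finset ι) (hT : T ⊆ Ω)
    [∀ S : Finset ι, Decidable (T ⊆ S)] :
    ∑ S ∈ Ω.powerset, wgt Ω y S * (if T ⊆ S then 1 else 0) = ∏ i ∈ T, y i := by
  have h1 : ∀ S ∈ Ω.powerset, wgt Ω y S * (if T ⊆ S then 1 else 0) =
      (∏ i ∈ S, y i) * ∏ i ∈ Ω \ S, (if i ∈ T then 0 else (1 - y i)) := by
    intro S hS
    unfold wgt
    by_cases h : T ⊆ S
    · rw [if_pos h, mul_one]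
      congr 1
      apply prod_congr rfl
      intro i hi
      rw [if_neg]
      exact fun hiT => (mem_sdiff.1 hi).2 (h hiT)
    · rw [if_neg h, mul_zero]
      obtain ⟨i, hiT, hiS⟩ := not_subset.1 h
      rw [prod_eq_zero (i := i) (mem_sdiff.2 ⟨hT hiT, hiS⟩) (by simp [hiT]), mul_zero]
  rw [sum_congr rfl h1, ← prod_add]
  have h2 : ∀ i ∈ Ω, (y i + if i ∈ T then 0 else (1 - y i)) = if i ∈ T then y i else 1 := by
    intro i _
    split_ifs <;> ring
  rw [prod_congr rfl h2, prod_ite_mem, inter_eq_right.2 hT]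

lemma wgt_nonneg {ι : Type*} (Ω : Finset ι) (y : ι → ℝ) (h0 : ∀ i ∈ Ω, 0 ≤ y i)
    (h1 : ∀ i ∈ Ω, y i ≤ 1) (S : Finset ι) (hS : S ⊆ Ω) : 0 ≤ wgt Ω y S := by
  apply mul_nonneg
  · exact prod_nonneg (fun i hi => h0 i (hS hi))
  · exact prod_nonneg (fun i hi => by have := h1 i (mem_sdiff.1 hi).1; linarith)

lemma weighted_bound {α : Type*} (V : Finset (ℝ × ℝ)) (a b : α → ℝ × ℝ)
    (arc : α → Set (ℝ × ℝ)) (E : Finset α)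
    (ha : ∀ e ∈ E, a e ∈ V) (hb : ∀ e ∈ E, b e ∈ V)
    (hab : ∀ e ∈ E, a e ≠ b e) (harc : ∀ e ∈ E, JoinedIn (arc e) (a e) (b e))
    (x : ℝ × ℝ → ℝ) (hx0 : ∀ p ∈ V, 0 < x p) (hx1 : ∀ p ∈ V, x p ≤ 1) (κ : ℝ) (hκ : 0 < κ)
    (hμ : ∀ e ∈ E, ((E.filter (fun f => Par a b e f)).card : ℝ) * κ ≤ x (a e) * x (b e) / 2) :
    κ * E.card / 2 ≤ 8 * ∑ p ∈ V, x p + κ ^ 2 * (badPairs (Cross a b arc) E).card := by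
  set w : α → ℝ := fun e => κ / (x (a e) * x (b e)) with hw
  have hxx : ∀ e ∈ E, 0 < x (a e) * x (b e) := fun e he => mul_pos (hx0 _ (ha e he)) (hx0 _ (hb e he))
  have hw0 : ∀ e ∈ E, 0 ≤ w e := fun e he => (div_pos hκ (hxx e he)).le
  have hw1 : ∀ e ∈ E, w e ≤ 1 := by
    intro e he
    rw [hw]
    dsimp only
    rw [div_le_one (hxx e he)]
    have h := hμ e he
    have hc : (1:ℝ) ≤ ((E.filter (fun f => Par a b e f)).card : ℝ) := by
      have : 0 < (E.filter (fun f => Par a b e f)).card :=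
        card_pos.2 ⟨e, mem_filter.2 ⟨he, Or.inl ⟨rfl, rfl⟩⟩⟩
      exact_mod_cast this
    have := hxx e he
    nlinarith
  set Ω : Finset ((ℝ × ℝ) ⊕ α) := V.disjSum E with hΩ
  set y : (ℝ × ℝ) ⊕ α → ℝ := Sum.elim x w with hy
  have hy0 : ∀ i ∈ Ω, 0 ≤ y i := by
    rintro (p | e) hi
    · exact (hx0 p (by simpa [hΩ] using hi)).le
    · exact hw0 e (by simpa [hΩ] using hi)
  have hy1 : ∀ i ∈ Ω, y i ≤ 1 := by
    rintro (p | e) hi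
    · exact (hx1 p (by simpa [hΩ] using hi))
    · exact hw1 e (by simpa [hΩ] using hi)
  set BC := badPairs (Cross a b arc) E with hBC
  set BP := badPairs (fun e f => e ≠ f ∧ Par a b e f) E with hBP
  set T1 : α → Finset ((ℝ × ℝ) ⊕ α) := fun e => {Sum.inr e, Sum.inl (a e), Sum.inl (b e)} with hT1
  set T2 : (ℝ × ℝ) → Finset ((ℝ × ℝ) ⊕ α) := fun p => {Sum.inl p} with hT2
  set T3 : α × α → Finset ((ℝ × ℝ) ⊕ α) := fun p => {Sum.inr p.1, Sum.inr p.2, Sum.inl (a p.1),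
    Sum.inl (b p.1), Sum.inl (a p.2), Sum.inl (b p.2)} with hT3
  set T4 : α × α → Finset ((ℝ × ℝ) ⊕ α) := fun p => {Sum.inr p.1, Sum.inr p.2, Sum.inl (a p.1),
    Sum.inl (b p.1)} with hT4
  have key : ∀ S ∈ Ω.powerset, ∑ e ∈ E, (if T1 e ⊆ S then (1:ℝ) else 0) ≤
      8 * ∑ p ∈ V, (if T2 p ⊆ S then (1:ℝ) else 0) + ∑ p ∈ BC, (if T3 p ⊆ S then (1:ℝ) else 0)
      + ∑ p ∈ BP, (if T4 p ⊆ S then (1:ℝ) else 0) := by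
    intro S hS
    simp only [sum_boole]
    have hl := linear_bound (V.filter (fun p => T2 p ⊆ S)) a b arc _ (E.filter (fun e => T1 e ⊆ S)) rfl
      (by
        intro e he
        obtain ⟨he, h⟩ := mem_filter.1 he
        refine mem_filter.2 ⟨ha e he, ?_⟩
        simp only [hT1, hT2, insert_subset_iff, singleton_subset_iff] at h ⊢
        exact h.2.1)
      (by
        intro e he
        obtain ⟨he, h⟩ := mem_filter.1 he
        refine mem_filter.2 ⟨hb e he, ?_⟩
        simp only [hT1, hT2, insert_subset_iff, singleton_subset_iff] at h ⊢
        exact h.2.2)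
      (fun e he => hab e (mem_filter.1 he).1) (fun e he => harc e (mem_filter.1 he).1)
    have h3 : (badPairs (Cross a b arc) (E.filter (fun e => T1 e ⊆ S))).card ≤
        (BC.filter (fun p => T3 p ⊆ S)).card := by
      apply card_le_card
      rintro ⟨e, f⟩ h
      simp only [badPairs, hBC, mem_filter, mem_product, hT1, hT3, insert_subset_iff,
        singleton_subset_iff] at h ⊢
      tauto
    have h4 : (badPairs (fun e f => e ≠ f ∧ Par a b e f) (E.filter (fun e => T1 e ⊆ S))).card ≤
        (BP.filter (fun p => T4 p ⊆ S)).card := by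
      apply card_le_card
      rintro ⟨e, f⟩ h
      simp only [badPairs, hBP, mem_filter, mem_product, hT1, hT4, insert_subset_iff,
        singleton_subset_iff] at h ⊢
      tauto
    have := hl.trans (add_le_add (add_le_add le_rfl h3) h4)
    exact_mod_cast this
  have hsum := sum_le_sum (fun S hS => mul_le_mul_of_nonneg_left (key S hS)
    (wgt_nonneg Ω y hy0 hy1 S (mem_powerset.1 hS)))
  simp only [mul_add, mul_sum, sum_add_distrib] at hsum
  rw [sum_comm, sum_comm (s := Ω.powerset) (t := V), sum_comm (s := Ω.powerset) (t := BC),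
    sum_comm (s := Ω.powerset) (t := BP)] at hsum
  have s1 : ∀ e ∈ E, ∑ S ∈ Ω.powerset, wgt Ω y S * (if T1 e ⊆ S then 1 else 0) = κ := by
    intro e he
    rw [wgt_sum]
    · simp only [hT1, hy, hw]
      rw [prod_insert (by simp), prod_insert (by simpa using hab e he), prod_singleton]
      simp only [Sum.elim_inr, Sum.elim_inl]
      exact div_mul_cancel₀ _ (hxx e he).ne'
    · simp only [hT1, insert_subset_iff, singleton_subset_iff, hΩ]
      simp [he, ha e he, hb e he]
  have s2 : ∀ p ∈ V, ∑ S ∈ Ω.powerset, wgt Ω y S * (8 * (if T2 p ⊆ S then 1 else 0)) = 8 * x p := by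
    intro p hp
    have : ∑ S ∈ Ω.powerset, wgt Ω y S * (if T2 p ⊆ S then 1 else 0) = x p := by
      rw [wgt_sum]
      · simp [hT2, hy]
      · simp [hT2, hΩ, hp]
    rw [← this, mul_sum]
    exact sum_congr rfl (fun _ _ => by ring)
  have s3 : ∀ p ∈ BC, ∑ S ∈ Ω.powerset, wgt Ω y S * (if T3 p ⊆ S then 1 else 0) = κ ^ 2 := by
    rintro ⟨e, f⟩ hp
    simp only [hBC, badPairs, mem_filter, mem_product] at hp
    obtain ⟨⟨he, hf⟩, ⟨n1, n2, n3, n4⟩, -⟩ := hp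
    have hef : e ≠ f := fun h => n1 (by rw [h])
    rw [wgt_sum]
    · simp only [hT3, hy, hw]
      rw [prod_insert (by simp [hef]), prod_insert (by simp),
        prod_insert (by simp [n1, n2, hab e he]), prod_insert (by simp [n3, n4]),
        prod_insert (by simp [hab f hf]), prod_singleton]
      simp only [Sum.elim_inr, Sum.elim_inl]
      have := (hx0 _ (ha e he)).ne'
      have := (hx0 _ (hb e he)).ne'
      have := (hx0 _ (ha f hf)).ne'
      have := (hx0 _ (hb f hf)).ne'
      field_simp
    · simp only [hT3, insert_subset_iff, singleton_subset_iff, hΩ]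
      simp [he, ha e he, hb e he, hf, ha f hf, hb f hf]
  have s4 : ∀ p ∈ BP, ∑ S ∈ Ω.powerset, wgt Ω y S * (if T4 p ⊆ S then 1 else 0) =
      κ ^ 2 / (x (a p.1) * x (b p.1)) := by
    rintro ⟨e, f⟩ hp
    simp only [hBP, badPairs, mem_filter, mem_product] at hp
    obtain ⟨⟨he, hf⟩, hef, hpar⟩ := hp
    rw [wgt_sum]
    · simp only [hT4, hy, hw]
      rw [prod_insert (by simp [hef]), prod_insert (by simp),
        prod_insert (by simp [hab e he]), prod_singleton]
      simp only [Sum.elim_inr, Sum.elim_inl]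
      have := (hx0 _ (ha e he)).ne'
      have := (hx0 _ (hb e he)).ne'
      have hh : x (a f) * x (b f) = x (a e) * x (b e) := by
        rcases hpar with ⟨h1, h2⟩ | ⟨h1, h2⟩
        · rw [h1, h2]
        · rw [h1, h2, mul_comm]
      rw [hh]
      field_simp
    · simp only [hT4, insert_subset_iff, singleton_subset_iff, hΩ]
      simp [he, ha e he, hb e he, hf]
  rw [sum_congr rfl s1, sum_congr rfl s2, sum_congr rfl s3, sum_congr rfl s4] at hsum
  have s5 : ∑ p ∈ BP, κ ^ 2 / (x (a p.1) * x (b p.1)) ≤ ∑ e ∈ E, κ / 2 := by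
    calc ∑ p ∈ BP, κ ^ 2 / (x (a p.1) * x (b p.1))
        ≤ ∑ p ∈ (E ×ˢ E).filter (fun p => Par a b p.1 p.2), κ ^ 2 / (x (a p.1) * x (b p.1)) := by
          apply sum_le_sum_of_subset_of_nonneg
          · intro p hp
            simp only [hBP, badPairs, mem_filter] at hp ⊢
            tauto
          · rintro p hp -
            simp only [mem_filter, mem_product] at hp
            exact (div_pos (by positivity) (hxx _ hp.1.1)).le
      _ = ∑ e ∈ E, ∑ f ∈ E.filter (fun f => Par a b e f), κ ^ 2 / (x (a e) * x (b e)) := by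
          rw [sum_filter, sum_product]
          exact sum_congr rfl (fun e _ => (sum_filter _ _).symm)
      _ ≤ ∑ e ∈ E, κ / 2 := by
          apply sum_le_sum
          intro e he
          rw [sum_const, nsmul_eq_mul]
          have h1 := hμ e he
          have h2 := hxx e he
          rw [mul_div_assoc', div_le_iff₀ h2]
          nlinarith
  simp only [sum_const, nsmul_eq_mul, ← mul_sum] at hsum s5
  linarith

end PS

namespace PS

open Finset

lemma exists_param (γ : Set (ℝ × ℝ)) (h : IsSimpleCurve γ) : ∃ τ : ℝ × ℝ → ℝ, Set.InjOn τ γ ∧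
    ∀ p ∈ γ, ∀ q ∈ γ, τ p ≤ τ q → JoinedIn {z | z ∈ γ ∧ τ p ≤ τ z ∧ τ z ≤ τ q} p q := by
  obtain ⟨f, hf, hinj, rfl⟩ := h
  set τ : ℝ × ℝ → ℝ := fun z => ((Function.invFun f z : Set.Icc (0:ℝ) 1) : ℝ) with hτ
  have hτf : ∀ s, τ (f s) = s := by
    intro s
    simp only [hτ]
    rw [Function.leftInverse_invFun hinj s]
  refine ⟨τ, ?_, ?_⟩
  · rintro _ ⟨s, rfl⟩ _ ⟨t, rfl⟩ h
    rw [hτf, hτf] at h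
    rw [Subtype.ext h]
  · rintro _ ⟨s, rfl⟩ _ ⟨t, rfl⟩ h
    rw [hτf, hτf] at *
    have h1 : IsPathConnected (Set.Icc (s:ℝ) t) := (convex_Icc _ _).isPathConnected ⟨_, Set.left_mem_Icc.2 h⟩
    set g : ℝ → ℝ × ℝ := fun u => f (Set.projIcc 0 1 zero_le_one u) with hg
    have hgc : Continuous g := hf.comp continuous_projIcc
    have h2 := (h1.image hgc).joinedIn (g s) ⟨s, Set.left_mem_Icc.2 h, rfl⟩ (g t)
      ⟨t, Set.right_mem_Icc.2 h, rfl⟩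
    simp only [hg, Set.projIcc_val] at h2
    refine h2.mono ?_
    rintro _ ⟨u, hu, rfl⟩
    have hu' : u ∈ Set.Icc (0:ℝ) 1 := ⟨s.2.1.trans hu.1, hu.2.trans t.2.2⟩
    refine ⟨⟨_, rfl⟩, ?_⟩
    dsimp only
    rw [hτf, Set.projIcc_of_mem zero_le_one hu']
    exact hu

/-- the type of edges (curve, left endpoint, right endpoint) -/
abbrev Edge := Set (ℝ × ℝ) × (ℝ × ℝ) × (ℝ × ℝ)

/-- left endpoint -/
def eL (e : Edge) : ℝ × ℝ := e.2.1
/-- right endpoint -/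
def eR (e : Edge) : ℝ × ℝ := e.2.2

/-- consecutive points of U along the curve -/
def Cons (τ : Set (ℝ × ℝ) → ℝ × ℝ → ℝ) (U : Finset (ℝ × ℝ)) (e : Edge) : Prop :=
  eL e ∈ e.1 ∧ eR e ∈ e.1 ∧ τ e.1 (eL e) < τ e.1 (eR e) ∧
    ∀ r ∈ U, r ∈ e.1 → ¬ (τ e.1 (eL e) < τ e.1 r ∧ τ e.1 r < τ e.1 (eR e))

/-- arc of an edge -/
def eArc (τ : Set (ℝ × ℝ) → ℝ × ℝ → ℝ) (e : Edge) : Set (ℝ × ℝ) :=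
  {z | z ∈ e.1 ∧ τ e.1 (eL e) ≤ τ e.1 z ∧ τ e.1 z ≤ τ e.1 (eR e)}

/-- the drawn graph -/
noncomputable def Gr (τ : Set (ℝ × ℝ) → ℝ × ℝ → ℝ) (C : Finset (Set (ℝ × ℝ)))
    (U : Finset (ℝ × ℝ)) : Finset Edge :=
  (C ×ˢ (U ×ˢ U)).filter (fun e => Cons τ U e)

/-- degree of a point -/
noncomputable def deg (C : Finset (Set (ℝ × ℝ))) (p : ℝ × ℝ) : ℕ := (C.filter (fun γ => p ∈ γ)).card

/-- good parametrization data -/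
def Good (τ : Set (ℝ × ℝ) → ℝ × ℝ → ℝ) (C : Finset (Set (ℝ × ℝ))) : Prop :=
  ∀ γ ∈ C, Set.InjOn (τ γ) γ ∧
    ∀ p ∈ γ, ∀ q ∈ γ, τ γ p ≤ τ γ q → JoinedIn {z | z ∈ γ ∧ τ γ p ≤ τ γ z ∧ τ γ z ≤ τ γ q} p q

lemma exists_good (C : Finset (Set (ℝ × ℝ))) (h : ∀ γ ∈ C, IsSimpleCurve γ) : ∃ τ, Good τ C := by
  have : ∀ γ : Set (ℝ × ℝ), ∃ τ : ℝ × ℝ → ℝ, γ ∈ C → (Set.InjOn τ γ ∧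
    ∀ p ∈ γ, ∀ q ∈ γ, τ p ≤ τ q → JoinedIn {z | z ∈ γ ∧ τ p ≤ τ z ∧ τ z ≤ τ q} p q) := by
    intro γ
    by_cases hγ : γ ∈ C
    · obtain ⟨τ, hτ⟩ := exists_param γ (h γ hγ)
      exact ⟨τ, fun _ => hτ⟩
    · exact ⟨fun _ => 0, fun h => absurd h hγ⟩
  choose τ hτ using this
  exact ⟨τ, fun γ hγ => hτ γ hγ⟩

lemma mem_Gr {τ : Set (ℝ × ℝ) → ℝ × ℝ → ℝ} {C : Finset (Set (ℝ × ℝ))}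
    {U : Finset (ℝ × ℝ)} {e : Edge} :
    e ∈ Gr τ C U ↔ (e.1 ∈ C ∧ eL e ∈ U ∧ eR e ∈ U) ∧ Cons τ U e := by
  unfold Gr
  rw [mem_filter, mem_product, mem_product]
  rfl

lemma arc_vertex {τ : Set (ℝ × ℝ) → ℝ × ℝ → ℝ} {C : Finset (Set (ℝ × ℝ))} (hτ : Good τ C)
    {U : Finset (ℝ × ℝ)} {e : Edge} (he : e ∈ Gr τ C U) {z : ℝ × ℝ} (hz : z ∈ eArc τ e) (hU : z ∈ U) :
    z = eL e ∨ z = eR e := by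
  obtain ⟨⟨h1, h2, h3⟩, h4, h5, h6, h7⟩ := mem_Gr.1 he
  obtain ⟨z1, z2, z3⟩ := hz
  have hi := (hτ _ h1).1
  have := h7 z hU z1
  by_contra! hne
  apply this
  constructor
  · exact lt_of_le_of_ne z2 (fun h => hne.1 (hi h4 z1 h).symm)
  · exact lt_of_le_of_ne z3 (fun h => hne.2 (hi z1 h5 h))

lemma arc_unique {τ : Set (ℝ × ℝ) → ℝ × ℝ → ℝ} {C : Finset (Set (ℝ × ℝ))} (hτ : Good τ C)
    {U : Finset (ℝ × ℝ)} {e f : Edge} (he : e ∈ Gr τ C U) (hf : f ∈ Gr τ C U) (hef : e.1 = f.1)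
    {z : ℝ × ℝ} (hz : z ∈ eArc τ e) (hz' : z ∈ eArc τ f) (hU : z ∉ U) : e = f := by
  obtain ⟨γ, p, q⟩ := e
  obtain ⟨γ', p', q'⟩ := f
  dsimp only at hef
  subst hef
  obtain ⟨⟨h1, h2, h3⟩, h4, h5, h6, h7⟩ := mem_Gr.1 he
  obtain ⟨⟨g1, g2, g3⟩, g4, g5, g6, g7⟩ := mem_Gr.1 hf
  obtain ⟨z1, z2, z3⟩ := hz
  obtain ⟨w1, w2, w3⟩ := hz'
  dsimp only [eL, eR] at *
  have hi := (hτ _ h1).1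
  have ne : ∀ r ∈ U, r ∈ γ → τ γ r ≠ τ γ z := fun r hr hrγ h => hU (hi hrγ z1 h ▸ hr)
  have a1 := lt_of_le_of_ne z2 (ne p h2 h4)
  have a2 := lt_of_le_of_ne z3 (ne q h3 h5).symm
  have a3 := lt_of_le_of_ne w2 (ne p' g2 g4)
  have a4 := lt_of_le_of_ne w3 (ne q' g3 g5).symm
  have e1 : τ γ p = τ γ p' := by
    rcases lt_trichotomy (τ γ p) (τ γ p') with h | h | h
    · exact absurd ⟨h, a3.trans a2⟩ (h7 p' g2 g4)
    · exact h
    · exact absurd ⟨h, a1.trans a4⟩ (g7 p h2 h4)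
  have e2 : τ γ q = τ γ q' := by
    rcases lt_trichotomy (τ γ q) (τ γ q') with h | h | h
    · exact absurd ⟨a3.trans a2, h⟩ (g7 q h3 h5)
    · exact h
    · exact absurd ⟨a1.trans a4, h⟩ (h7 q' g3 g5)
  rw [hi h4 g4 e1, hi h5 g5 e2]

lemma cross_le {τ : Set (ℝ × ℝ) → ℝ × ℝ → ℝ} {C : Finset (Set (ℝ × ℝ))} (hτ : Good τ C)
    (hfin : ∀ γ ∈ C, ∀ γ' ∈ C, γ ≠ γ' → (γ ∩ γ').Finite)
    (P U : Finset (ℝ × ℝ)) :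
    (badPairs (Cross eL eR (eArc τ)) (Gr τ C U)).card ≤
      (∑ e ∈ C.offDiag, ((e.1 ∩ e.2) \ (↑P : Set (ℝ × ℝ))).ncard) + ∑ q ∈ P \ U, (deg C q) ^ 2 := by
  have hfin' : ∀ (Q : Finset (ℝ × ℝ)), ∀ e ∈ C.offDiag, ((e.1 ∩ e.2) \ (↑Q : Set (ℝ × ℝ))).Finite := by
    intro Q e he
    obtain ⟨h1, h2, h3⟩ := mem_offDiag.1 he
    exact (hfin _ h1 _ h2 h3).sdiff
  have step1 : (badPairs (Cross eL eR (eArc τ)) (Gr τ C U)).card ≤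
      ∑ e ∈ C.offDiag, ((e.1 ∩ e.2) \ (↑U : Set (ℝ × ℝ))).ncard := by
    have : ∀ e : Set (ℝ × ℝ) × Set (ℝ × ℝ), ∃ F : Finset (ℝ × ℝ), e ∈ C.offDiag →
        ((F : Set (ℝ × ℝ)) = (e.1 ∩ e.2) \ (↑U : Set (ℝ × ℝ))) := by
      intro e
      by_cases he : e ∈ C.offDiag
      · exact ⟨(hfin' U e he).toFinset, fun _ => by simp⟩
      · exact ⟨∅, fun h => absurd h he⟩
    choose F hF using this
    have e1 : ∑ e ∈ C.offDiag, ((e.1 ∩ e.2) \ (↑U : Set (ℝ × ℝ))).ncard = (C.offDiag.sigma F).card := by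
      rw [card_sigma]
      refine sum_congr rfl (fun e he => ?_)
      rw [← hF e he, Set.ncard_coe_finset]
    rw [e1]
    have hz : ∀ p : Edge × Edge, ∃ z, Cross eL eR (eArc τ) p.1 p.2 → z ∈ eArc τ p.1 ∧ z ∈ eArc τ p.2 := by
      intro p
      by_cases h : Cross eL eR (eArc τ) p.1 p.2
      · obtain ⟨z, hz⟩ := h.2
        exact ⟨z, fun _ => hz⟩
      · exact ⟨0, fun h' => absurd h' h⟩
    choose z hz using hz
    have prop : ∀ p ∈ badPairs (Cross eL eR (eArc τ)) (Gr τ C U), p.1 ∈ Gr τ C U ∧ p.2 ∈ Gr τ C U ∧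
        z p ∈ eArc τ p.1 ∧ z p ∈ eArc τ p.2 ∧ z p ∉ U ∧ p.1.1 ≠ p.2.1 := by
      intro p hp
      obtain ⟨hp, hc⟩ := mem_filter.1 hp
      obtain ⟨h1, h2⟩ := mem_product.1 hp
      obtain ⟨z1, z2⟩ := hz p hc
      obtain ⟨n1, n2, n3, n4⟩ := hc.1
      have hU : z p ∉ U := by
        intro hU
        rcases arc_vertex hτ h1 z1 hU with h | h <;> rcases arc_vertex hτ h2 z2 hU with h' | h' <;>
          simp_all
      refine ⟨h1, h2, z1, z2, hU, fun h => ?_⟩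
      exact n1 (by rw [arc_unique hτ h1 h2 h z1 z2 hU])
    apply card_le_card_of_injOn (fun p => (⟨(p.1.1, p.2.1), z p⟩ : (_ : Set (ℝ × ℝ) × Set (ℝ × ℝ)) × (ℝ × ℝ)))
    · intro p hp
      obtain ⟨h1, h2, z1, z2, hU, hne⟩ := prop p hp
      have hm : (p.1.1, p.2.1) ∈ C.offDiag := mem_offDiag.2 ⟨(mem_Gr.1 h1).1.1, (mem_Gr.1 h2).1.1, hne⟩
      rw [mem_coe, mem_sigma]
      refine ⟨hm, ?_⟩
      dsimp only
      rw [← mem_coe, hF _ hm]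
      exact ⟨⟨z1.1, z2.1⟩, hU⟩
    · intro p hp p' hp' heq
      obtain ⟨h1, h2, z1, z2, hU, hne⟩ := prop p hp
      obtain ⟨h1', h2', z1', z2', hU', hne'⟩ := prop p' hp'
      simp only [Sigma.mk.injEq, Prod.mk.injEq, heq_eq_eq] at heq
      obtain ⟨⟨g1, g2⟩, g3⟩ := heq
      rw [← g3] at z1' z2'
      exact Prod.ext (arc_unique hτ h1 h1' g1 z1 z1' hU) (arc_unique hτ h2 h2' g2 z2 z2' hU)
  refine step1.trans ?_
  have step2 : ∀ e ∈ C.offDiag, ((e.1 ∩ e.2) \ (↑U : Set (ℝ × ℝ))).ncard ≤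
      ((e.1 ∩ e.2) \ (↑P : Set (ℝ × ℝ))).ncard + ((P \ U).filter (fun q => q ∈ e.1 ∧ q ∈ e.2)).card := by
    intro e he
    rw [← Set.ncard_coe_finset]
    refine le_trans (Set.ncard_le_ncard ?_ ?_) (Set.ncard_union_le _ _)
    · rintro q ⟨⟨q1, q2⟩, q3⟩
      by_cases hq : q ∈ P
      · right
        simp only [coe_filter, mem_sdiff, Set.mem_ofPred_eq]
        exact ⟨⟨hq, q3⟩, q1, q2⟩
      · left
        exact ⟨⟨q1, q2⟩, hq⟩
    · exact (hfin' P e he).union (finite_toSet _)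
  refine (sum_le_sum step2).trans ?_
  rw [sum_add_distrib]
  refine Nat.add_le_add_left ?_ _
  simp only [card_filter]
  rw [sum_comm]
  refine sum_le_sum (fun q _ => ?_)
  rw [← card_filter, sq]
  unfold deg
  rw [← card_product]
  apply card_le_card
  intro e he
  simp only [mem_filter, mem_offDiag, mem_product] at he ⊢
  tauto

/-- multiplicity -/
noncomputable def mult (τ : Set (ℝ × ℝ) → ℝ × ℝ → ℝ) (C : Finset (Set (ℝ × ℝ)))
    (U : Finset (ℝ × ℝ)) (p q : ℝ × ℝ) : ℕ :=
  ((Gr τ C U).filter (fun e => (p = eL e ∧ q = eR e) ∨ (p = eR e ∧ q = eL e))).card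

lemma outdeg_le {τ : Set (ℝ × ℝ) → ℝ × ℝ → ℝ} {C : Finset (Set (ℝ × ℝ))} (hτ : Good τ C)
    (U : Finset (ℝ × ℝ)) (p : ℝ × ℝ) : ((Gr τ C U).filter (fun e => p = eL e)).card ≤ deg C p := by
  apply card_le_card_of_injOn (fun e => e.1)
  · intro e he
    obtain ⟨he', rfl⟩ := mem_filter.1 he
    obtain ⟨⟨h1, h2, h3⟩, h4, h5, h6, h7⟩ := mem_Gr.1 he'
    exact mem_filter.2 ⟨h1, h4⟩
  · rintro ⟨γ, p', q⟩ he ⟨γ', p'', q'⟩ hf h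
    dsimp only at h
    subst h
    obtain ⟨he, e0⟩ := mem_filter.1 he
    obtain ⟨hf, f0⟩ := mem_filter.1 hf
    dsimp only [eL] at e0 f0
    subst e0; subst f0
    obtain ⟨⟨h1, h2, h3⟩, h4, h5, h6, h7⟩ := mem_Gr.1 he
    obtain ⟨⟨g1, g2, g3⟩, g4, g5, g6, g7⟩ := mem_Gr.1 hf
    dsimp only [eL, eR] at *
    have e2 : τ γ q = τ γ q' := by
      rcases lt_trichotomy (τ γ q) (τ γ q') with h | h | h
      · exact absurd ⟨h6, h⟩ (g7 q h3 h5)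
      · exact h
      · exact absurd ⟨g6, h⟩ (h7 q' g3 g5)
    rw [(hτ _ h1).1 h5 g5 e2]

lemma indeg_le {τ : Set (ℝ × ℝ) → ℝ × ℝ → ℝ} {C : Finset (Set (ℝ × ℝ))} (hτ : Good τ C)
    (U : Finset (ℝ × ℝ)) (p : ℝ × ℝ) : ((Gr τ C U).filter (fun e => p = eR e)).card ≤ deg C p := by
  apply card_le_card_of_injOn (fun e => e.1)
  · intro e he
    obtain ⟨he', rfl⟩ := mem_filter.1 he
    obtain ⟨⟨h1, h2, h3⟩, h4, h5, h6, h7⟩ := mem_Gr.1 he'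
    exact mem_filter.2 ⟨h1, h5⟩
  · rintro ⟨γ, q, p'⟩ he ⟨γ', q', p''⟩ hf h
    dsimp only at h
    subst h
    obtain ⟨he, e0⟩ := mem_filter.1 he
    obtain ⟨hf, f0⟩ := mem_filter.1 hf
    dsimp only [eR] at e0 f0
    subst e0; subst f0
    obtain ⟨⟨h1, h2, h3⟩, h4, h5, h6, h7⟩ := mem_Gr.1 he
    obtain ⟨⟨g1, g2, g3⟩, g4, g5, g6, g7⟩ := mem_Gr.1 hf
    dsimp only [eL, eR] at *
    have e2 : τ γ q = τ γ q' := by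
      rcases lt_trichotomy (τ γ q) (τ γ q') with h | h | h
      · exact absurd ⟨h, g6⟩ (h7 q' g2 g4)
      · exact h
      · exact absurd ⟨h, h6⟩ (g7 q h2 h4)
    rw [(hτ _ h1).1 h4 g4 e2]

lemma sum_mult_le {τ : Set (ℝ × ℝ) → ℝ × ℝ → ℝ} {C : Finset (Set (ℝ × ℝ))} (hτ : Good τ C)
    (U H : Finset (ℝ × ℝ)) (p : ℝ × ℝ) : ∑ q ∈ H, mult τ C U p q ≤ 2 * deg C p := by
  have h1 : ∀ q ∈ H, mult τ C U p q ≤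
      (((Gr τ C U).filter (fun e => p = eL e)).filter (fun e => eR e = q)).card +
      (((Gr τ C U).filter (fun e => p = eR e)).filter (fun e => eL e = q)).card := by
    intro q _
    unfold mult
    refine le_trans (card_le_card ?_) (card_union_le _ _)
    intro e he
    simp only [mem_filter, mem_union] at he ⊢
    obtain ⟨h, h' | h'⟩ := he
    · exact Or.inl ⟨⟨h, h'.1⟩, h'.2.symm⟩
    · exact Or.inr ⟨⟨h, h'.1⟩, h'.2.symm⟩
  refine (sum_le_sum h1).trans ?_
  rw [sum_add_distrib]
  have aux : ∀ (X : Finset Edge) (g : Edge → ℝ × ℝ),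
      ∑ q ∈ H, (X.filter (fun e => g e = q)).card ≤ X.card := by
    intro X g
    rw [← card_biUnion]
    · apply card_le_card
      intro e he
      obtain ⟨q, _, h⟩ := mem_biUnion.1 he
      exact (mem_filter.1 h).1
    · intro q _ q' _ hne
      rw [Function.onFun, disjoint_left]
      intro e h h'
      exact hne ((mem_filter.1 h).2.symm.trans (mem_filter.1 h').2)
  have a1 := aux ((Gr τ C U).filter (fun e => p = eL e)) eR
  have a2 := aux ((Gr τ C U).filter (fun e => p = eR e)) eL
  have b1 := outdeg_le hτ U p
  have b2 := indeg_le hτ U p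
  omega

end PS

namespace PS

open Finset

/-- light edges -/
noncomputable def LE (τ : Set (ℝ × ℝ) → ℝ × ℝ → ℝ) (C : Finset (Set (ℝ × ℝ)))
    (U : Finset (ℝ × ℝ)) (θ : ℝ) (x : ℝ × ℝ → ℝ) : Finset Edge :=
  (Gr τ C U).filter (fun e => (mult τ C U (eL e) (eR e) : ℝ) ≤ θ * (x (eL e) * x (eR e)))

lemma light_scale {τ : Set (ℝ × ℝ) → ℝ × ℝ → ℝ} {C : Finset (Set (ℝ × ℝ))} (hτ : Good τ C)
    (hfin : ∀ γ ∈ C, ∀ γ' ∈ C, γ ≠ γ' → (γ ∩ γ').Finite)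
    (P U : Finset (ℝ × ℝ)) (θ : ℝ) (hθ : 0 < θ) (x : ℝ × ℝ → ℝ) (hx0 : ∀ p ∈ U, 0 < x p)
    (hx1 : ∀ p ∈ U, x p ≤ 1) (M : ℕ)
    (hM : M = ∑ e ∈ C.offDiag, ((e.1 ∩ e.2) \ (↑P : Set (ℝ × ℝ))).ncard) :
    ((LE τ C U θ x).card : ℝ) ≤ 32 * ∑ p ∈ U, θ * x p + (M + ∑ q ∈ P \ U, (deg C q : ℝ) ^ 2) / θ := by
  have hsub : LE τ C U θ x ⊆ Gr τ C U := filter_subset _ _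
  have hw := weighted_bound U eL eR (eArc τ) (LE τ C U θ x)
    (fun e he => (mem_Gr.1 (hsub he)).1.2.1) (fun e he => (mem_Gr.1 (hsub he)).1.2.2)
    (fun e he h => by
      have := (mem_Gr.1 (hsub he)).2.2.2.1
      rw [h] at this
      exact lt_irrefl _ this)
    (fun e he => by
      obtain ⟨⟨h1, h2, h3⟩, h4, h5, h6, h7⟩ := mem_Gr.1 (hsub he)
      exact (hτ _ h1).2 _ h4 _ h5 h6.le)
    x hx0 hx1 (1 / (2 * θ)) (by positivity)
    (fun e he => by
      have h1 := (mem_filter.1 he).2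
      have h2 : ((LE τ C U θ x).filter (fun f => Par eL eR e f)).card ≤ mult τ C U (eL e) (eR e) := by
        apply card_le_card
        intro f hf
        obtain ⟨f1, f2⟩ := mem_filter.1 hf
        exact mem_filter.2 ⟨hsub f1, f2⟩
      have h3 : (((LE τ C U θ x).filter (fun f => Par eL eR e f)).card : ℝ) ≤ mult τ C U (eL e) (eR e) := by
        exact_mod_cast h2
      have h4 := h3.trans h1
      rw [mul_one_div, div_le_iff₀ (by positivity)]
      linarith)
  have hc := cross_le hτ hfin P U
  have hc2 : ((badPairs (Cross eL eR (eArc τ)) (LE τ C U θ x)).card : ℝ) ≤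
      M + ∑ q ∈ P \ U, (deg C q : ℝ) ^ 2 := by
    have : (badPairs (Cross eL eR (eArc τ)) (LE τ C U θ x)).card ≤ 
        M + ∑ q ∈ P \ U, (deg C q) ^ 2 := by
      rw [hM]
      refine le_trans (card_le_card ?_) hc
      exact filter_subset_filter _ (product_subset_product hsub hsub)
    exact_mod_cast this
  rw [← mul_sum]
  have h3 : (1 / (2 * θ)) * (LE τ C U θ x).card / 2 * (4 * θ) ≤ (8 * ∑ p ∈ U, x p +
      (1 / (2 * θ)) ^ 2 * (M + ∑ q ∈ P \ U, (deg C q : ℝ) ^ 2)) * (4 * θ) := by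
    apply mul_le_mul_of_nonneg_right _ (by positivity)
    refine hw.trans ?_
    gcongr
  have e1 : (1 / (2 * θ)) * ((LE τ C U θ x).card : ℝ) / 2 * (4 * θ) = (LE τ C U θ x).card := by
    field_simp
    ring
  have e2 : (8 * ∑ p ∈ U, x p +
      (1 / (2 * θ)) ^ 2 * (M + ∑ q ∈ P \ U, (deg C q : ℝ) ^ 2)) * (4 * θ) =
      32 * (θ * ∑ p ∈ U, x p) + (M + ∑ q ∈ P \ U, (deg C q : ℝ) ^ 2) / θ := by
    field_simp
    ring
  rw [e1, e2] at h3
  exact h3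

lemma geo_pos (T : ℕ → ℝ) (hT0 : 0 < T 0) (hT : ∀ j, 2 * T j ≤ T (j+1)) (j : ℕ) : 0 < T j := by
  induction j with
  | zero => exact hT0
  | succ j ih => have := hT j; linarith

lemma geo1 (T : ℕ → ℝ) (hT0 : 0 < T 0) (hT : ∀ j, 2 * T j ≤ T (j+1)) (D : ℝ) (hD : 0 ≤ D)
    (J : ℕ) : ∑ j ∈ range J, (if T j ≤ D then min (T (j+1)) D else 0) ≤ 3 * D ∧
      (T J ≤ D → ∑ j ∈ range J, (if T j ≤ D then min (T (j+1)) D else 0) ≤ 2 * T J) := by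
  induction J with
  | zero => simp; constructor <;> intros <;> linarith
  | succ J ih =>
    rw [sum_range_succ]
    obtain ⟨h1, h2⟩ := ih
    have h3 := geo_pos T hT0 hT J
    have h4 := hT J
    split_ifs with h
    · have h5 := h2 h
      have h6 := min_le_right (T (J+1)) D
      have h7 := min_le_left (T (J+1)) D
      constructor
      · linarith
      · intro _; linarith
    · push Not at h
      constructor
      · linarith
      · intro h'; linarith

lemma geo2 (T : ℕ → ℝ) (hT0 : 0 < T 0) (hT : ∀ j, 2 * T j ≤ T (j+1)) (D : ℝ) (hD : 0 ≤ D)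
    (J : ℕ) : (D < T J → ∑ j ∈ range J, (if D < T j then D / T j else 0) ≤ 2 - 2 * D / T J) ∧
      (T J ≤ D → ∑ j ∈ range J, (if D < T j then D / T j else 0) ≤ 0) := by
  induction J with
  | zero =>
    simp only [range_zero, sum_empty, le_refl, implies_true, and_true]
    intro h
    have : 2 * D / T 0 ≤ 2 := by rw [div_le_iff₀ hT0]; linarith
    linarith
  | succ J ih =>
    rw [sum_range_succ]
    obtain ⟨h1, h2⟩ := ih
    have h3 := geo_pos T hT0 hT J
    have h3' := geo_pos T hT0 hT (J+1)
    have h4 := hT J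
    have h5 : 2 * D / T (J+1) ≤ D / T J := by
      rw [div_le_div_iff₀ h3' h3]
      nlinarith
    have h6 : 2 * D / T J = 2 * (D / T J) := by ring
    split_ifs with h
    · have := h1 h
      constructor
      · intro _; linarith
      · intro h'; linarith
    · push Not at h
      have := h2 h
      constructor
      · intro h'
        have : 2 * D / T (J+1) ≤ 2 := by rw [div_le_iff₀ h3']; linarith
        linarith
      · intro h'; linarith

lemma geo3 (T : ℕ → ℝ) (hT0 : 0 < T 0) (hT : ∀ j, 2 * T j ≤ T (j+1)) (J : ℕ) :
    ∑ j ∈ range J, 1 / T (j+1) ≤ 2 / T 1 - 2 / T (J+1) := by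
  induction J with
  | zero => simp
  | succ J ih =>
    rw [sum_range_succ]
    have h3 := geo_pos T hT0 hT (J+1)
    have h3' := geo_pos T hT0 hT (J+1+1)
    have h4 := hT (J+1)
    have h5 : 2 / T (J+1+1) ≤ 1 / T (J+1) := by
      rw [div_le_div_iff₀ h3' h3]
      linarith
    have h6 : 2 / T (J+1) = 2 * (1 / T (J+1)) := by ring
    linarith

/-- points of large degree -/
noncomputable def UU (C : Finset (Set (ℝ × ℝ))) (P : Finset (ℝ × ℝ)) (T : ℝ) : Finset (ℝ × ℝ) :=
  P.filter (fun p => T ≤ (deg C p : ℝ))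

/-- normalized weights -/
noncomputable def xx (C : Finset (Set (ℝ × ℝ))) (T : ℝ) (p : ℝ × ℝ) : ℝ := min 1 ((deg C p : ℝ) / T)

lemma light_total {τ : Set (ℝ × ℝ) → ℝ × ℝ → ℝ} {C : Finset (Set (ℝ × ℝ))} (hτ : Good τ C)
    (hfin : ∀ γ ∈ C, ∀ γ' ∈ C, γ ≠ γ' → (γ ∩ γ').Finite)
    (P : Finset (ℝ × ℝ)) (M : ℕ)
    (hM : M = ∑ e ∈ C.offDiag, ((e.1 ∩ e.2) \ (↑P : Set (ℝ × ℝ))).ncard)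
    (T : ℕ → ℝ) (hT0 : 0 < T 0) (B : ℝ) (hB : 2 ≤ B) (hT : ∀ j, B * T j ≤ T (j+1)) (ε : ℝ) (hε : 0 < ε)
    (J : ℕ) :
    ∑ j ∈ range J, ((LE τ C (UU C P (T j)) (ε * T (j+1)) (xx C (T (j+1)))).card : ℝ) ≤
      96 * ε * (∑ p ∈ P, (deg C p : ℝ)) + 2 / (ε * B) * (∑ p ∈ P, (deg C p : ℝ)) + 2 * M / (ε * T 1) := by
  have hTp : ∀ j, 0 < T j := by
    intro j
    induction j with
    | zero => exact hT0
    | succ j ih => have := hT j; nlinarith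
  have hT2 : ∀ j, 2 * T j ≤ T (j+1) := fun j => by have := hT j; have := hTp j; nlinarith
  have h1 : ∀ j ∈ range J, ((LE τ C (UU C P (T j)) (ε * T (j+1)) (xx C (T (j+1)))).card : ℝ) ≤
      32 * ε * ∑ p ∈ P, (if T j ≤ (deg C p : ℝ) then min (T (j+1)) (deg C p) else 0) +
      1 / (ε * B) * (∑ p ∈ P, (if (deg C p : ℝ) < T j then (deg C p : ℝ) / T j else 0) * deg C p) +
      M / ε * (1 / T (j+1)) := by
    intro j _
    have hp := hTp j
    have hp1 := hTp (j+1)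
    have hl := light_scale hτ hfin P (UU C P (T j)) (ε * T (j+1)) (by positivity) (xx C (T (j+1)))
      (fun p hp' => by
        have := (mem_filter.1 hp').2
        unfold xx
        exact lt_min one_pos (div_pos (by linarith) hp1))
      (fun p _ => min_le_left _ _) M hM
    refine hl.trans ?_
    have e1 : ∑ p ∈ UU C P (T j), ε * T (j+1) * xx C (T (j+1)) p =
        ε * ∑ p ∈ P, (if T j ≤ (deg C p : ℝ) then min (T (j+1)) (deg C p) else 0) := by
      rw [← sum_filter, mul_sum]
      refine sum_congr rfl (fun p _ => ?_)
      unfold xx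
      rw [mul_assoc, mul_min_of_nonneg _ _ hp1.le, mul_one, mul_div_cancel₀ _ hp1.ne']
    have e2 : P \ UU C P (T j) = P.filter (fun p => (deg C p : ℝ) < T j) := by
      ext p
      simp only [UU, mem_sdiff, mem_filter, not_and, not_le]
      tauto
    have e3 : (∑ q ∈ P \ UU C P (T j), (deg C q : ℝ) ^ 2) / (ε * T (j+1)) ≤
        1 / (ε * B) * (∑ p ∈ P, (if (deg C p : ℝ) < T j then (deg C p : ℝ) / T j else 0) * deg C p) := by
      rw [e2, sum_filter, sum_div, mul_sum]
      refine sum_le_sum (fun p _ => ?_)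
      split_ifs
      · have hB0 : 0 < B := by linarith
        have : 1 / (ε * B) * ((deg C p : ℝ) / T j * deg C p) = (deg C p : ℝ) ^ 2 / (ε * (B * T j)) := by
          field_simp
        rw [this]
        gcongr
        exact hT j
      · simp
    rw [e1, add_div]
    have e4 : (M : ℝ) / (ε * T (j+1)) = M / ε * (1 / T (j+1)) := by field_simp
    rw [e4]
    linarith
  refine (sum_le_sum h1).trans ?_
  rw [sum_add_distrib, sum_add_distrib, ← mul_sum, ← mul_sum, ← mul_sum]
  have hB0 : 0 < B := by linarith
  have k1 : ∑ j ∈ range J, ∑ p ∈ P, (if T j ≤ (deg C p : ℝ) then min (T (j+1)) (deg C p) else 0) ≤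
      3 * ∑ p ∈ P, (deg C p : ℝ) := by
    rw [sum_comm, mul_sum]
    exact sum_le_sum (fun p _ => (geo1 T hT0 hT2 _ (by positivity) J).1)
  have k2 : ∑ j ∈ range J, ∑ p ∈ P, (if (deg C p : ℝ) < T j then (deg C p : ℝ) / T j else 0) * deg C p ≤
      2 * ∑ p ∈ P, (deg C p : ℝ) := by
    rw [sum_comm, mul_sum]
    refine sum_le_sum (fun p _ => ?_)
    rw [← sum_mul]
    apply mul_le_mul_of_nonneg_right _ (by positivity)
    obtain ⟨g1, g2⟩ := geo2 T hT0 hT2 (deg C p) (by positivity) J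
    rcases lt_or_ge (deg C p : ℝ) (T J) with h | h
    · have : 0 ≤ 2 * (deg C p : ℝ) / T J := div_nonneg (by positivity) (hTp J).le
      linarith [g1 h]
    · linarith [g2 h]
  have k3 : ∑ j ∈ range J, 1 / T (j+1) ≤ 2 / T 1 := by
    have := geo3 T hT0 hT2 J
    have : 0 ≤ 2 / T (J+1) := div_nonneg (by positivity) (hTp (J+1)).le
    linarith
  have l1 := mul_le_mul_of_nonneg_left k1 (show 0 ≤ 32 * ε by positivity)
  have l2 := mul_le_mul_of_nonneg_left k2 (show 0 ≤ 1 / (ε * B) by positivity)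
  have l3 := mul_le_mul_of_nonneg_left k3 (show 0 ≤ (M:ℝ) / ε by positivity)
  have m2 : 1 / (ε * B) * (2 * ∑ p ∈ P, (deg C p : ℝ)) = 2 / (ε * B) * ∑ p ∈ P, (deg C p : ℝ) := by ring
  have m3 : (M:ℝ) / ε * (2 / T 1) = 2 * M / (ε * T 1) := by
    have := (hTp 1).ne'
    field_simp
  linarith

end PS

namespace PS

open Finset

/-- order-convex subsets -/
def OC {V : Type*} (t : V → ℝ) (W J : Finset V) : Prop :=
  J ⊆ W ∧ ∀ p ∈ J, ∀ q ∈ J, ∀ r ∈ W, t p < t r → t r < t q → r ∈ J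

/-- step to the next point of at least the same rank -/
def Stp {V : Type*} (t : V → ℝ) (s : V → ℕ) (W : Finset V) (p q : V) : Prop :=
  p ≠ q ∧ s p ≤ s q ∧ ∀ r ∈ W, s p ≤ s r → ¬ (t p < t r ∧ t r < t q) ∧ ¬ (t q < t r ∧ t r < t p)

/-- exploration families -/
noncomputable def EX {V : Type*} (H : V → Finset V) : ℕ → V → Finset (Finset V)
  | 0, x => {{x}}
  | d+1, x => (EX H d x).biUnion (fun A => (A.biUnion H).image (fun q => insert q A))

lemma EX_card_mem {V : Type*} (H : V → Finset V) (d : ℕ) (x : V) :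
    ∀ A ∈ EX H d x, A.card ≤ d + 1 := by
  induction d with
  | zero => intro A hA; simp [EX] at hA; simp [hA]
  | succ d ih =>
    intro A hA
    simp only [EX, mem_biUnion, mem_image] at hA
    obtain ⟨A', hA', q, _, rfl⟩ := hA
    have := card_insert_le q A'
    have := ih A' hA'
    omega

lemma EX_subset {V : Type*} (H : V → Finset V) (P : Finset V) (hH : ∀ p ∈ P, H p ⊆ P) (d : ℕ) (x : V)
    (hx : x ∈ P) : ∀ A ∈ EX H d x, A ⊆ P := by
  induction d with
  | zero => intro A hA; simp [EX] at hA; simpa [hA] using hx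
  | succ d ih =>
    intro A hA
    simp only [EX, mem_biUnion, mem_image] at hA
    obtain ⟨A', hA', q, ⟨p, hp, hq⟩, rfl⟩ := hA
    exact insert_subset (hH p (ih A' hA' hp) hq) (ih A' hA')

lemma EX_card {V : Type*} (H : V → Finset V) (P : Finset V) (hH : ∀ p ∈ P, H p ⊆ P) (b : ℝ)
    (hb : ∀ p ∈ P, ((H p).card : ℝ) ≤ b) (hb0 : 0 ≤ b) (d : ℕ) (x : V)
    (hx : x ∈ P) : ((EX H d x).card : ℝ) ≤ (d.factorial : ℝ) * b ^ d := by
  induction d with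
  | zero => simp [EX]
  | succ d ih =>
    have h1 : ∀ A ∈ EX H d x, ((((A.biUnion H).image (fun q => insert q A)).card : ℕ) : ℝ) ≤ (d+1) * b := by
      intro A hA
      have a1 : (((A.biUnion H).image (fun q => insert q A)).card : ℝ) ≤ ∑ p ∈ A, ((H p).card : ℝ) := by
        exact_mod_cast card_image_le.trans card_biUnion_le
      have a2 : ∑ p ∈ A, ((H p).card : ℝ) ≤ A.card • b :=
        sum_le_card_nsmul _ _ _ (fun p hp => hb p (EX_subset H P hH d x hx A hA hp))
      have a3 : (A.card : ℝ) ≤ d + 1 := by exact_mod_cast EX_card_mem H d x A hA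
      rw [nsmul_eq_mul] at a2
      nlinarith
    have h2 : ((EX H (d+1) x).card : ℝ) ≤
        ∑ A ∈ EX H d x, ((((A.biUnion H).image (fun q => insert q A)).card : ℕ) : ℝ) := by
      have : (EX H (d+1) x).card ≤
        ∑ A ∈ EX H d x, ((A.biUnion H).image (fun q => insert q A)).card := card_biUnion_le
      exact_mod_cast this
    have h3 := sum_le_card_nsmul _ _ _ h1
    rw [nsmul_eq_mul] at h3
    have h4 : ((EX H d x).card : ℝ) * ((d+1) * b) ≤ ((d.factorial : ℝ) * b ^ d) * ((d+1) * b) :=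
      mul_le_mul_of_nonneg_right ih (by positivity)
    rw [Nat.factorial_succ]
    push_cast
    calc _ ≤ _ := h2
      _ ≤ _ := h3
      _ ≤ _ := h4
      _ = _ := by ring

lemma Stp_neg {V : Type*} {t : V → ℝ} {s : V → ℕ} {W : Finset V} {p q : V}
    (h : Stp t s W p q) : Stp (fun v => - t v) s W p q := by
  refine ⟨h.1, h.2.1, fun r hr hs => ?_⟩
  have := h.2.2 r hr hs
  simp only [neg_lt_neg_iff]
  tauto

lemma OC_neg {V : Type*} {t : V → ℝ} {W J : Finset V} (h : OC t W J) : OC (fun v => - t v) W J := by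
  refine ⟨h.1, fun p hp q hq r hr h1 h2 => ?_⟩
  simp only [neg_lt_neg_iff] at h1 h2
  exact h.2 q hq p hp r hr h2 h1

lemma expl_ext {V : Type*} (H : V → Finset V) (s : V → ℕ) (W : Finset V) (d : ℕ) (t : V → ℝ)
    (J : Finset V) (hJ : OC t W J)
    (hN : ∀ p ∈ J, ∀ q ∈ J, Stp t s W p q → q ∈ H p) (z : V) (hz : z ∈ J) (hmax : ∀ p ∈ J, s p ≤ s z)
    (x : V) (A : Finset V) (hA : A ⊆ J) (hlt : ∀ p ∈ A, t p < t z) (hAne : A.Nonempty)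
    (hE : A ∈ EX H d x) : ∃ A' ∈ EX H (d+1) x, A' ⊆ J ∧ A'.card = A.card + 1 := by
  obtain ⟨w, hw, hwmax⟩ := exists_max_image A t hAne
  obtain ⟨q, hq, hqmin⟩ := exists_min_image (J.filter (fun q => t w < t q ∧ s w ≤ s q)) t
    ⟨z, mem_filter.2 ⟨hz, hlt w hw, hmax w (hA hw)⟩⟩
  obtain ⟨hqJ, hq1, hq2⟩ := mem_filter.1 hq
  have hst : Stp t s W w q := by
    refine ⟨fun h => by rw [h] at hq1; exact lt_irrefl _ hq1, hq2, fun r hr hs => ⟨?_, ?_⟩⟩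
    · rintro ⟨h1, h2⟩
      have hrJ := hJ.2 w (hA hw) q hqJ r hr h1 h2
      have := hqmin r (mem_filter.2 ⟨hrJ, h1, hs⟩)
      linarith
    · rintro ⟨h1, h2⟩
      linarith
  have hqA : q ∉ A := fun h => by have := hwmax q h; linarith
  refine ⟨insert q A, ?_, insert_subset hqJ hA, card_insert_of_notMem hqA⟩
  simp only [EX, mem_biUnion, mem_image]
  exact ⟨A, hE, q, ⟨w, hw, hN w (hA hw) q hqJ hst⟩, rfl⟩

lemma OC_lt {V : Type*} {t : V → ℝ} {W J : Finset V} (h : OC t W J) (z : V) (hz : z ∈ J) :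
    OC t W (J.filter (fun p => t p < t z)) := by
  refine ⟨(filter_subset _ _).trans h.1, fun p hp q hq r hr h1 h2 => ?_⟩
  obtain ⟨hp1, hp2⟩ := mem_filter.1 hp
  obtain ⟨hq1, hq2⟩ := mem_filter.1 hq
  exact mem_filter.2 ⟨h.2 p hp1 q hq1 r hr h1 h2, h2.trans hq2⟩

lemma expl {V : Type*} (H : V → Finset V) (s : V → ℕ) (W : Finset V) (d : ℕ) : ∀ (t : V → ℝ)
    (_ : Set.InjOn t W) (J : Finset V) (_ : OC t W J)
    (_ : ∀ p ∈ J, ∀ q ∈ J, Stp t s W p q → q ∈ H p) (_ : 2 ^ d ≤ J.card),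
    ∃ x ∈ J, ∃ A ∈ EX H d x, A ⊆ J ∧ A.card = d + 1 := by
  induction d with
  | zero =>
    intro t ht J hJ hN hc
    obtain ⟨x, hx⟩ := card_pos.1 (by simpa using hc : 0 < J.card)
    exact ⟨x, hx, {x}, by simp [EX], by simpa using hx, by simp⟩
  | succ d ih =>
    intro t ht J hJ hN hc
    have hpos : 0 < J.card := lt_of_lt_of_le (by positivity) hc
    obtain ⟨z, hz, hmax⟩ := exists_max_image J s (card_pos.1 hpos)
    have hcov : J ⊆ insert z (J.filter (fun p => t p < t z) ∪ J.filter (fun p => - t p < - t z)) := by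
      intro p hp
      simp only [mem_insert, mem_union, mem_filter, neg_lt_neg_iff]
      rcases lt_trichotomy (t p) (t z) with h | h | h
      · exact Or.inr (Or.inl ⟨hp, h⟩)
      · exact Or.inl (ht (hJ.1 hp) (hJ.1 hz) h)
      · exact Or.inr (Or.inr ⟨hp, h⟩)
    have hcc := (card_le_card hcov).trans ((card_insert_le _ _).trans
      (Nat.add_le_add_right (card_union_le _ _) 1))
    have main : ∀ t : V → ℝ, Set.InjOn t W → OC t W J →
        (∀ p ∈ J, ∀ q ∈ J, Stp t s W p q → q ∈ H p) → 2 ^ d ≤ (J.filter (fun p => t p < t z)).card →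
        ∃ x ∈ J, ∃ A ∈ EX H (d+1) x, A ⊆ J ∧ A.card = d + 1 + 1 := by
      intro t ht hJ hN hc
      have hsub : (J.filter (fun p => t p < t z)) ⊆ J := filter_subset _ _
      obtain ⟨x, hx, A, hA, hAJ, hAc⟩ := ih t ht _ (OC_lt hJ z hz)
        (fun p hp q hq h => hN p (hsub hp) q (hsub hq) h) hc
      obtain ⟨A', h1, h2, h3⟩ := expl_ext H s W d t J hJ hN z hz hmax x A (hAJ.trans hsub)
        (fun p hp => (mem_filter.1 (hAJ hp)).2) (card_pos.1 (by omega)) hA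
      exact ⟨x, hsub hx, A', h1, h2, by omega⟩
    by_cases h : 2 ^ d ≤ (J.filter (fun p => t p < t z)).card
    · exact main t ht hJ hN h
    · refine main (fun v => - t v) (fun p hp q hq h => ht hp hq (neg_injective h)) (OC_neg hJ) ?_ ?_
      · intro p hp q hq h
        apply hN p hp q hq
        simpa using Stp_neg h
      · have : 2 ^ (d+1) = 2 ^ d + 2 ^ d := by ring
        omega

lemma covering {V : Type*} (t : V → ℝ) (W Z : Finset V) (ht : Set.InjOn t W) (hZ : Z ⊆ W) (L : ℕ)
    (hL : 0 < L) (h : ∀ J, OC t W J → L ≤ J.card → ∃ z ∈ J, z ∈ Z) : W.card ≤ L * (Z.card + 1) := by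
  set c : V → ℕ := fun p => (Z.filter (fun z => t z < t p)).card with hc
  have hmono : ∀ p q, t p ≤ t q → c p ≤ c q := by
    intro p q hpq
    apply card_le_card
    intro z hz
    obtain ⟨h1, h2⟩ := mem_filter.1 hz
    exact mem_filter.2 ⟨h1, h2.trans_le hpq⟩
  have hfib : ∀ i ∈ range (Z.card + 1), ((W \ Z).filter (fun p => c p = i)).card ≤ L - 1 := by
    intro i _
    by_contra! hlt
    obtain ⟨z, hz, hzZ⟩ := h ((W \ Z).filter (fun p => c p = i)) (by
      refine ⟨fun p hp => (mem_sdiff.1 (mem_filter.1 hp).1).1, fun p hp q hq r hr h1 h2 => ?_⟩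
      obtain ⟨hp1, hp2⟩ := mem_filter.1 hp
      obtain ⟨hq1, hq2⟩ := mem_filter.1 hq
      have m1 := hmono p r h1.le
      have m2 := hmono r q h2.le
      refine mem_filter.2 ⟨mem_sdiff.2 ⟨hr, fun hrZ => ?_⟩, by omega⟩
      have : c r < c q := by
        apply card_lt_card
        refine ⟨fun z hz => ?_, fun hh => ?_⟩
        · obtain ⟨g1, g2⟩ := mem_filter.1 hz
          exact mem_filter.2 ⟨g1, g2.trans h2⟩
        · have := hh (mem_filter.2 ⟨hrZ, h2⟩)
          exact lt_irrefl _ (mem_filter.1 this).2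
      omega) (by omega)
    exact (mem_sdiff.1 (mem_filter.1 hz).1).2 hzZ
  have h1 : (W \ Z).card = ∑ i ∈ range (Z.card + 1), ((W \ Z).filter (fun p => c p = i)).card := by
    apply card_eq_sum_card_fiberwise
    intro p _
    rw [mem_coe, mem_range]
    exact Nat.lt_succ_of_le (card_filter_le _ _)
  have h2 := sum_le_card_nsmul _ _ _ hfib
  rw [← h1, card_range, smul_eq_mul] at h2
  have h3 := card_sdiff_add_card_eq_card hZ
  obtain ⟨L', rfl⟩ : ∃ L', L = L' + 1 := ⟨L - 1, by omega⟩
  simp only [Nat.add_sub_cancel] at h2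
  nlinarith

end PS

namespace PS

open Finset

/-- scale of a point -/
noncomputable def sc (C : Finset (Set (ℝ × ℝ))) (T : ℕ → ℝ) (J : ℕ) (p : ℝ × ℝ) : ℕ :=
  Nat.findGreatest (fun j => T j ≤ (deg C p : ℝ)) J

/-- heavy neighbours -/
noncomputable def HN (τ : Set (ℝ × ℝ) → ℝ × ℝ → ℝ) (C : Finset (Set (ℝ × ℝ))) (P : Finset (ℝ × ℝ))
    (T : ℕ → ℝ) (J : ℕ) (ε : ℝ) (p : ℝ × ℝ) : Finset (ℝ × ℝ) :=
  (UU C P (T (sc C T J p))).filter (fun q => ¬ ((mult τ C (UU C P (T (sc C T J p))) p q : ℝ) ≤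
    ε * T (sc C T J p + 1) * (xx C (T (sc C T J p + 1)) p * xx C (T (sc C T J p + 1)) q)))

lemma mult_symm (τ : Set (ℝ × ℝ) → ℝ × ℝ → ℝ) (C : Finset (Set (ℝ × ℝ)))
    (U : Finset (ℝ × ℝ)) (p q : ℝ × ℝ) : mult τ C U p q = mult τ C U q p := by
  unfold mult
  congr 1
  apply filter_congr
  intro e _
  tauto

lemma sc_spec (C : Finset (Set (ℝ × ℝ))) (T : ℕ → ℝ) (hmono : StrictMono T) (J : ℕ) (p : ℝ × ℝ)
    (h0 : T 0 ≤ (deg C p : ℝ)) (hJ : (deg C p : ℝ) < T J) :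
    T (sc C T J p) ≤ (deg C p : ℝ) ∧ (deg C p : ℝ) < T (sc C T J p + 1) ∧ sc C T J p < J := by
  have h1 : T (sc C T J p) ≤ (deg C p : ℝ) :=
    Nat.findGreatest_spec (P := fun j => T j ≤ (deg C p : ℝ)) (Nat.zero_le J) h0
  have h2 : sc C T J p < J := hmono.lt_iff_lt.1 (h1.trans_lt hJ)
  refine ⟨h1, ?_, h2⟩
  by_contra! hh
  exact Nat.findGreatest_is_greatest (P := fun j => T j ≤ (deg C p : ℝ)) (Nat.lt_succ_self _) h2 hh

lemma sc_le (C : Finset (Set (ℝ × ℝ))) (T : ℕ → ℝ) (hmono : StrictMono T) (J : ℕ) (q : ℝ × ℝ) (j : ℕ)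
    (hJ : (deg C q : ℝ) < T J) (h : T j ≤ (deg C q : ℝ)) : j ≤ sc C T J q := by
  have : j < J := hmono.lt_iff_lt.1 (h.trans_lt hJ)
  exact Nat.le_findGreatest this.le h

lemma HN_card {τ : Set (ℝ × ℝ) → ℝ × ℝ → ℝ} {C : Finset (Set (ℝ × ℝ))} (hτ : Good τ C)
    (P : Finset (ℝ × ℝ)) (T : ℕ → ℝ) (hmono : StrictMono T) (hT0 : 0 < T 0) (J : ℕ) (ε : ℝ) (hε : 0 < ε)
    (R : ℝ) (hR : ∀ j, T (j+1) ≤ R * T j) (p : ℝ × ℝ) (h0 : T 0 ≤ (deg C p : ℝ))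
    (hJ : (deg C p : ℝ) < T J) :
    ((HN τ C P T J ε p).card : ℝ) ≤ 2 * R / ε := by
  obtain ⟨h1, h2, h3⟩ := sc_spec C T hmono J p h0 hJ
  set j := sc C T J p with hj
  have hTj : ∀ i, 0 < T i := fun i => lt_of_lt_of_le hT0 (hmono.monotone (Nat.zero_le i))
  have hd : (0:ℝ) < deg C p := lt_of_lt_of_le hT0 h0
  have hxp : xx C (T (j+1)) p = deg C p / T (j+1) := by
    unfold xx
    exact min_eq_right ((div_le_one (hTj _)).2 h2.le)
  have hthr : ∀ q ∈ HN τ C P T J ε p,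
      ε * deg C p * (T j / T (j+1)) ≤ (mult τ C (UU C P (T j)) p q : ℝ) := by
    intro q hq
    obtain ⟨q1, q2⟩ := mem_filter.1 hq
    rw [← hj] at q1 q2
    have q3 := (mem_filter.1 q1).2
    push Not at q2
    refine le_trans ?_ q2.le
    have hxq : T j / T (j+1) ≤ xx C (T (j+1)) q := by
      unfold xx
      apply le_min
      · rw [div_le_one (hTj _)]
        exact (hmono (Nat.lt_succ_self j)).le
      · exact div_le_div_of_nonneg_right q3 (hTj _).le
    rw [hxp]
    have : ε * T (j+1) * (deg C p / T (j+1) * xx C (T (j+1)) q) = ε * deg C p * xx C (T (j+1)) q := by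
      have := (hTj (j+1)).ne'
      field_simp
    rw [this]
    exact mul_le_mul_of_nonneg_left hxq (by positivity)
  have hs := card_nsmul_le_sum _ _ _ hthr
  have hs2 : ∑ q ∈ HN τ C P T J ε p, (mult τ C (UU C P (T j)) p q : ℝ) ≤ 2 * deg C p := by
    exact_mod_cast sum_mult_le hτ (UU C P (T j)) (HN τ C P T J ε p) p
  rw [nsmul_eq_mul] at hs
  have h4 := hs.trans hs2
  have hq : 1 / R ≤ T j / T (j+1) := by
    have hRpos : 0 < R := by
      have := hR j
      have a := hTj j
      have b := hTj (j+1)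
      by_contra! hh
      nlinarith
    rw [div_le_div_iff₀ hRpos (hTj _)]
    linarith [hR j]
  have hRpos : 0 < R := by
    have := hR j
    have a := hTj j
    have b := hTj (j+1)
    by_contra! hh
    nlinarith
  have h5 : ((HN τ C P T J ε p).card : ℝ) * (ε * deg C p * (1 / R)) ≤ 2 * deg C p := by
    refine le_trans ?_ h4
    gcongr
  rw [le_div_iff₀ hε]
  have h6 : ((HN τ C P T J ε p).card : ℝ) * (ε * deg C p * (1 / R)) =
    (((HN τ C P T J ε p).card : ℝ) * ε / R) * deg C p := by field_simp
  rw [h6] at h5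
  have h7 := le_of_mul_le_mul_right h5 hd
  rw [div_le_iff₀ hRpos] at h7
  exact h7

lemma dcount (X : Finset (Set (ℝ × ℝ))) (Y : Finset (ℝ × ℝ)) (r : Set (ℝ × ℝ) → ℝ × ℝ → Prop) :
    ∑ γ ∈ X, (Y.filter (fun p => r γ p)).card = ∑ p ∈ Y, (X.filter (fun γ => r γ p)).card := by
  simp only [card_filter]
  exact sum_comm

lemma main_count {τ : Set (ℝ × ℝ) → ℝ × ℝ → ℝ} {C : Finset (Set (ℝ × ℝ))} (hτ : Good τ C) (k : ℕ)
    (hfin : ∀ γ ∈ C, ∀ γ' ∈ C, γ ≠ γ' → (γ ∩ γ').Finite ∧ (γ ∩ γ').ncard ≤ k)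
    (P : Finset (ℝ × ℝ)) (T : ℕ → ℝ) (hmono : StrictMono T) (hT0 : 0 < T 0) (J : ℕ)
    (hJ : ∀ p ∈ P, (deg C p : ℝ) < T J) (ε : ℝ) (hε : 0 < ε)
    (R : ℝ) (hR0 : 0 < R) (hR : ∀ j, T (j+1) ≤ R * T j) :
    ∑ p ∈ UU C P (T 0), (deg C p : ℝ) ≤ 2 ^ k * (C.card +
      2 * ∑ j ∈ range J, ((LE τ C (UU C P (T j)) (ε * T (j+1)) (xx C (T (j+1)))).card : ℝ) +
      P.card * (k.factorial * (2 * R / ε) ^ k)) := by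
  set U0 := UU C P (T 0) with hU0
  set Lj : ℕ → Finset Edge := fun j => LE τ C (UU C P (T j)) (ε * T (j+1)) (xx C (T (j+1))) with hLj
  set H := HN τ C P T J ε with hH
  set r1 : Set (ℝ × ℝ) → ℝ × ℝ → Prop := fun γ p =>
    ∃ j ∈ range J, ∃ e ∈ Lj j, e.1 = γ ∧ (eL e = p ∨ eR e = p) with hr1
  set r2 : Set (ℝ × ℝ) → ℝ × ℝ → Prop := fun γ p =>
    ∃ A ∈ EX H k p, A.card = k + 1 ∧ (A : Set (ℝ × ℝ)) ⊆ γ with hr2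
  have hU0P : U0 ⊆ P := filter_subset _ _
  have hHU : ∀ p ∈ U0, H p ⊆ U0 := by
    intro p hp q hq
    obtain ⟨q1, -⟩ := mem_filter.1 hq
    obtain ⟨q1, q2⟩ := mem_filter.1 q1
    exact mem_filter.2 ⟨q1, (hmono.monotone (Nat.zero_le _)).trans q2⟩
  have hEX : ∀ p ∈ U0, ((EX H k p).card : ℝ) ≤ k.factorial * (2 * R / ε) ^ k := by
    intro p hp
    refine EX_card H U0 hHU _ ?_ (by positivity) k p hp
    intro q hq
    exact HN_card hτ P T hmono hT0 J ε hε R hR q (mem_filter.1 hq).2 (hJ q (hU0P hq))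
  -- covering on every curve
  have hcov : ∀ γ ∈ C, (U0.filter (fun p => p ∈ γ)).card ≤
      2 ^ k * ((U0.filter (fun p => r1 γ p)).card + (U0.filter (fun p => r2 γ p)).card + 1) := by
    intro γ hγ
    set W := U0.filter (fun p => p ∈ γ) with hW
    have hWγ : ∀ p ∈ W, p ∈ γ := fun p hp => (mem_filter.1 hp).2
    have hWU : ∀ p ∈ W, p ∈ U0 := fun p hp => (mem_filter.1 hp).1
    have hinj : Set.InjOn (τ γ) W := fun p hp q hq h =>
      (hτ γ hγ).1 (hWγ p hp) (hWγ q hq) h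
    have hc := covering (τ γ) W (W.filter (fun p => r1 γ p ∨ r2 γ p)) hinj (filter_subset _ _) (2 ^ k)
      (by positivity) (by
        intro K hK hKc
        by_cases hN : ∀ p ∈ K, ∀ q ∈ K, Stp (τ γ) (sc C T J) W p q → q ∈ H p
        · obtain ⟨x, hx, A, hA, hAK, hAc⟩ := expl H (sc C T J) W k (τ γ) hinj K hK hN hKc
          exact ⟨x, hx, mem_filter.2 ⟨hK.1 hx, Or.inr ⟨A, hA, hAc, fun y hy => hWγ y (hK.1 (hAK hy))⟩⟩⟩
        · push Not at hN
          obtain ⟨p, hp, q, hq, ⟨hpq, hs, hst⟩, hqH⟩ := hN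
          have hpW := hK.1 hp
          have hqW := hK.1 hq
          have hpU := mem_filter.1 (hWU p hpW)
          have hqU := mem_filter.1 (hWU q hqW)
          obtain ⟨p1, p2, p3⟩ := sc_spec C T hmono J p hpU.2 (hJ p hpU.1)
          obtain ⟨q1, q2, q3⟩ := sc_spec C T hmono J q hqU.2 (hJ q hqU.1)
          have hpj : p ∈ UU C P (T (sc C T J p)) := mem_filter.2 ⟨hpU.1, p1⟩
          have hqj : q ∈ UU C P (T (sc C T J p)) :=
            mem_filter.2 ⟨hqU.1, (hmono.monotone hs).trans q1⟩
          have hlight : (mult τ C (UU C P (T (sc C T J p))) p q : ℝ) ≤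
            ε * T (sc C T J p + 1) * (xx C (T (sc C T J p + 1)) p * xx C (T (sc C T J p + 1)) q) := by
            by_contra hcon
            exact hqH (mem_filter.2 ⟨hqj, hcon⟩)
          have hbt : ∀ r ∈ UU C P (T (sc C T J p)), r ∈ γ →
              ¬ (τ γ p < τ γ r ∧ τ γ r < τ γ q) ∧ ¬ (τ γ q < τ γ r ∧ τ γ r < τ γ p) := by
            intro r hr hrγ
            obtain ⟨r1, r2⟩ := mem_filter.1 hr
            apply hst r
            · exact mem_filter.2 ⟨mem_filter.2 ⟨r1, (hmono.monotone (Nat.zero_le _)).trans r2⟩, hrγ⟩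
            · exact sc_le C T hmono J r _ (hJ r r1) r2
          refine ⟨p, hp, mem_filter.2 ⟨hpW, Or.inl ⟨sc C T J p, mem_range.2 p3, ?_⟩⟩⟩
          rcases lt_trichotomy (τ γ p) (τ γ q) with h | h | h
          · refine ⟨(γ, p, q), ?_, rfl, Or.inl rfl⟩
            refine mem_filter.2 ⟨mem_Gr.2 ⟨⟨hγ, hpj, hqj⟩, hWγ p hpW, hWγ q hqW, h, ?_⟩, hlight⟩
            exact fun r hr hrγ => (hbt r hr hrγ).1
          · exact absurd (hinj hpW hqW h) hpq
          · refine ⟨(γ, q, p), ?_, rfl, Or.inr rfl⟩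
            refine mem_filter.2 ⟨mem_Gr.2 ⟨⟨hγ, hqj, hpj⟩, hWγ q hqW, hWγ p hpW, h, ?_⟩, ?_⟩
            · exact fun r hr hrγ => (hbt r hr hrγ).2
            · rw [mult_symm, mul_comm (xx _ _ _) (xx _ _ _)]
              exact hlight)
    refine hc.trans ?_
    gcongr
    refine (card_le_card ?_).trans (card_union_le _ _)
    intro p hp
    obtain ⟨hp, h⟩ := mem_filter.1 hp
    rcases h with h | h
    · exact mem_union_left _ (mem_filter.2 ⟨hWU p hp, h⟩)
    · exact mem_union_right _ (mem_filter.2 ⟨hWU p hp, h⟩)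
  have hZ1 : ∑ γ ∈ C, (U0.filter (fun p => r1 γ p)).card ≤ 2 * ∑ j ∈ range J, (Lj j).card := by
    have e1 : ∑ γ ∈ C, (U0.filter (fun p => r1 γ p)).card =
        ((C ×ˢ U0).filter (fun z => r1 z.1 z.2)).card := by
      rw [card_filter, sum_product]
      exact sum_congr rfl (fun γ _ => card_filter _ _)
    rw [e1]
    have hsub : (C ×ˢ U0).filter (fun z => r1 z.1 z.2) ⊆
        (range J).biUnion (fun j => (Lj j).image (fun e => (e.1, eL e)) ∪
          (Lj j).image (fun e => (e.1, eR e))) := by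
      rintro ⟨γ, p⟩ hz
      obtain ⟨-, j, hj, e, he, h1, h2⟩ := mem_filter.1 hz
      dsimp only at h1 h2
      refine mem_biUnion.2 ⟨j, hj, ?_⟩
      rcases h2 with h2 | h2
      · exact mem_union_left _ (mem_image.2 ⟨e, he, by rw [h1, h2]⟩)
      · exact mem_union_right _ (mem_image.2 ⟨e, he, by rw [h1, h2]⟩)
    refine (card_le_card hsub).trans (card_biUnion_le.trans ?_)
    rw [mul_sum]
    refine sum_le_sum (fun j _ => ?_)
    have a1 := card_union_le ((Lj j).image (fun e => (e.1, eL e))) ((Lj j).image (fun e => (e.1, eR e)))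
    have a2 : ((Lj j).image (fun e => (e.1, eL e))).card ≤ (Lj j).card := card_image_le
    have a3 : ((Lj j).image (fun e => (e.1, eR e))).card ≤ (Lj j).card := card_image_le
    omega
  have hZ2 : ∑ γ ∈ C, (U0.filter (fun p => r2 γ p)).card ≤ ∑ p ∈ U0, (EX H k p).card := by
    have e0 : ∑ γ ∈ C, (U0.filter (fun p => r2 γ p)).card =
        ∑ p ∈ U0, (C.filter (fun γ => r2 γ p)).card := by
      simp only [card_filter]
      exact sum_comm
    rw [e0]
    refine sum_le_sum (fun p _ => ?_)
    have : ∀ γ : Set (ℝ × ℝ), ∃ A : Finset (ℝ × ℝ), r2 γ p →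
        A ∈ EX H k p ∧ A.card = k + 1 ∧ (A : Set (ℝ × ℝ)) ⊆ γ := by
      intro γ
      by_cases h : r2 γ p
      · obtain ⟨A, hA⟩ := h
        exact ⟨A, fun _ => hA⟩
      · exact ⟨∅, fun h' => absurd h' h⟩
    choose A hA using this
    apply card_le_card_of_injOn A
    · intro γ hγ
      exact (hA γ (mem_filter.1 hγ).2).1
    · intro γ hγ γ' hγ' heq
      by_contra hne
      obtain ⟨g1, g2⟩ := mem_filter.1 hγ
      obtain ⟨g1', g2'⟩ := mem_filter.1 hγ'
      obtain ⟨f1, f2⟩ := hfin γ g1 γ' g1' hne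
      obtain ⟨-, a2, a3⟩ := hA γ g2
      obtain ⟨-, b2, b3⟩ := hA γ' g2'
      rw [← heq] at b3
      have := Set.ncard_le_ncard (Set.subset_inter a3 b3) f1
      rw [Set.ncard_coe_finset] at this
      omega
  have hZ2' : ((∑ γ ∈ C, (U0.filter (fun p => r2 γ p)).card : ℕ) : ℝ) ≤
      P.card * (k.factorial * (2 * R / ε) ^ k) := by
    have a1 : ((∑ γ ∈ C, (U0.filter (fun p => r2 γ p)).card : ℕ) : ℝ) ≤
        ∑ p ∈ U0, ((EX H k p).card : ℝ) := by exact_mod_cast hZ2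
    have a2 := sum_le_card_nsmul _ _ _ hEX
    rw [nsmul_eq_mul] at a2
    refine a1.trans (a2.trans ?_)
    have : (U0.card : ℝ) ≤ P.card := by exact_mod_cast card_le_card hU0P
    gcongr
  have hsum := sum_le_sum hcov
  rw [← mul_sum, sum_add_distrib, sum_add_distrib, dcount] at hsum
  have hZ1' : ((∑ γ ∈ C, (U0.filter (fun p => r1 γ p)).card : ℕ) : ℝ) ≤
      2 * ∑ j ∈ range J, ((Lj j).card : ℝ) := by exact_mod_cast hZ1
  have hsum' : ((∑ p ∈ U0, (C.filter (fun γ => p ∈ γ)).card : ℕ) : ℝ) ≤ 2 ^ k *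
      (((∑ γ ∈ C, (U0.filter (fun p => r1 γ p)).card : ℕ) : ℝ) +
      ((∑ γ ∈ C, (U0.filter (fun p => r2 γ p)).card : ℕ) : ℝ) + (C.card : ℝ)) := by
    have : ∑ γ ∈ C, 1 = C.card := by simp
    rw [this] at hsum
    exact_mod_cast hsum
  have e0 : ∑ p ∈ U0, (deg C p : ℝ) = ((∑ p ∈ U0, (C.filter (fun γ => p ∈ γ)).card : ℕ) : ℝ) := by
    push_cast
    rfl
  rw [e0]
  refine hsum'.trans ?_
  apply mul_le_mul_of_nonneg_left _ (by positivity)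
  linarith

end PS

namespace PS

open Finset

lemma inc_eq (P : Finset (ℝ × ℝ)) (C : Finset (Set (ℝ × ℝ))) :
    (incidences P C : ℝ) = ∑ p ∈ P, (deg C p : ℝ) := by
  have : incidences P C = ∑ p ∈ P, deg C p := by
    unfold incidences deg
    simp only [card_filter]
    exact sum_comm
  rw [this]
  push_cast
  rfl

lemma rpow_final (k : ℕ) (hk : 1 ≤ k) (n t K m : ℝ) (hn : 0 < n) (ht : 0 < t) (hK : 1 ≤ K)
    (hm : 0 ≤ m) (h : n * t ^ (2 * k + 1) ≤ K * m) :
    n * t ^ k ≤ K * (n ^ (((k:ℝ) + 1) / (2 * (k:ℝ) + 1)) * m ^ ((k:ℝ) / (2 * (k:ℝ) + 1))) := by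
  have hd : (0:ℝ) < 2 * (k:ℝ) + 1 := by positivity
  set a : ℝ := (k:ℝ) / (2 * (k:ℝ) + 1) with ha
  have ha0 : 0 ≤ a := by positivity
  have ha1 : a ≤ 1 := by rw [ha, div_le_one hd]; have : (0:ℝ) ≤ k := by positivity
                         linarith
  have hb : ((k:ℝ) + 1) / (2 * (k:ℝ) + 1) = 1 - a := by rw [ha]; field_simp; ring
  rw [hb]
  have e1 : (n * t ^ (2 * k + 1)) ^ a ≤ (K * m) ^ a := Real.rpow_le_rpow (by positivity) h ha0
  rw [Real.mul_rpow hn.le (by positivity), Real.mul_rpow (by linarith) hm] at e1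
  have e2 : (t ^ (2 * k + 1)) ^ a = t ^ k := by
    rw [← Real.rpow_natCast, ← Real.rpow_mul ht.le, ← Real.rpow_natCast]
    congr 1
    push_cast
    rw [ha]
    field_simp
  rw [e2] at e1
  have e3 : K ^ a ≤ K := by
    have := Real.rpow_le_rpow_of_exponent_le hK ha1
    rwa [Real.rpow_one] at this
  have e4 : n ^ (1 - a) * n ^ a = n := by
    rw [← Real.rpow_add hn]; simp
  have p1 : 0 ≤ n ^ (1 - a) := by positivity
  have p2 : 0 ≤ m ^ a := by positivity
  calc n * t ^ k = n ^ (1 - a) * (n ^ a * t ^ k) := by rw [← mul_assoc, e4]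
    _ ≤ n ^ (1 - a) * (K ^ a * m ^ a) := by gcongr
    _ ≤ n ^ (1 - a) * (K * m ^ a) := by gcongr
    _ = _ := by ring

/-- The core inequality for a given value of the auxiliary parameter `t`. -/
lemma core (k : ℕ) (hk : 1 ≤ k) (P : Finset (ℝ × ℝ)) (C : Finset (Set (ℝ × ℝ))) (m : ℕ)
    (hC : KIntersecting C k)
    (hm : 2 * m = ∑ e ∈ C.offDiag, ((e.1 ∩ e.2) \ (↑P : Set (ℝ × ℝ))).ncard)
    (L ε B α t I n : ℝ) (hL : L = 2 ^ k) (hε : ε = 1 / (3072 * L)) (hB : B = 64 * L / ε)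
    (hα : α = ε / (16 * L * k.factorial)) (ht : 0 < t) (hI : I = ∑ p ∈ P, (deg C p : ℝ))
    (hn : n = P.card) (hIt : I = 2 * n * t ^ k) (htB : B ≤ α * t)
    (hIC : 16 * L * C.card ≤ I) :
    n * t ^ (2 * k + 1) ≤ 16 * L / (ε * α) * m := by
  have hL1 : 1 ≤ L := by rw [hL]; exact one_le_pow₀ (by norm_num)
  have hL0 : 0 < L := by linarith
  have hf1 : (1:ℝ) ≤ k.factorial := by exact_mod_cast Nat.succ_le_of_lt k.factorial_pos
  have hf0 : (0:ℝ) < k.factorial := by linarith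
  have hε0 : 0 < ε := by rw [hε]; positivity
  have hε1 : ε ≤ 1 := by
    rw [hε, div_le_one (by positivity)]; linarith
  have hB2 : 64 ≤ B := by
    rw [hB, le_div_iff₀ hε0]; nlinarith
  have hα0 : 0 < α := by rw [hα]; positivity
  have hn0 : 0 ≤ n := by rw [hn]; positivity
  set T0 : ℝ := t ^ k with hT0
  have hT00 : 0 < T0 := by positivity
  set T1 : ℝ := α * t * T0 with hT1
  have hT10 : 0 < T1 := by positivity
  let T : ℕ → ℝ := fun j => if j = 0 then T0 else T1 * B ^ (j - 1)
  have hTz : T 0 = T0 := by simp [T]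
  have hTs : ∀ j, T (j + 1) = T1 * B ^ j := by intro j; simp [T]
  have hTB : ∀ j, B * T j ≤ T (j + 1) := by
    intro j
    rcases j with _ | j
    · rw [hTs, hTz, pow_zero, mul_one, hT1]
      gcongr
    · rw [hTs, hTs, pow_succ]
      apply le_of_eq; ring
  have hTpos : ∀ j, 0 < T j := by
    intro j
    rcases j with _ | j
    · rw [hTz]; exact hT00
    · rw [hTs]; positivity
  have hmono : StrictMono T := by
    apply strictMono_nat_of_lt_succ
    intro j
    have := hTB j
    have := hTpos j
    nlinarith
  have hR : ∀ j, T (j + 1) ≤ (α * t) * T j := by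
    intro j
    rcases j with _ | j
    · rw [hTs, hTz, pow_zero, mul_one]
    · rw [hTs, hTs, pow_succ]
      have : 0 ≤ T1 * B ^ j := by positivity
      nlinarith
  obtain ⟨J, hJ⟩ : ∃ J : ℕ, (C.card : ℝ) < T (J + 1) := by
    obtain ⟨N, hN⟩ := pow_unbounded_of_one_lt ((C.card : ℝ) / T1) (by linarith : 1 < B)
    refine ⟨N, ?_⟩
    rw [hTs]
    rw [div_lt_iff₀ hT10] at hN
    linarith
  have hJ' : ∀ p ∈ P, (deg C p : ℝ) < T (J + 1) := by
    intro p _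
    refine lt_of_le_of_lt ?_ hJ
    exact_mod_cast card_filter_le _ _
  obtain ⟨τ, hτ⟩ := exists_good C hC.1
  have hM : ((2 * m : ℕ) : ℝ) = ((∑ e ∈ C.offDiag, ((e.1 ∩ e.2) \ (↑P : Set (ℝ × ℝ))).ncard : ℕ) : ℝ) := by
    exact_mod_cast hm
  have h1 := light_total hτ (fun γ h γ' h' hne => (hC.2 γ h γ' h' hne).1) P (2 * m) hm T
    (hTpos 0) B (by linarith) hTB ε hε0 (J + 1)
  have h2 := main_count hτ k hC.2 P T hmono (hTpos 0) (J + 1) hJ' ε hε0 (α * t) (by positivity) hR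
  have h3 : I / 2 ≤ ∑ p ∈ UU C P (T 0), (deg C p : ℝ) := by
    have e1 := sum_filter_add_sum_filter_not P (fun p => T 0 ≤ (deg C p : ℝ)) (fun p => (deg C p : ℝ))
    have e2 : ∑ p ∈ P.filter (fun p => ¬ T 0 ≤ (deg C p : ℝ)), (deg C p : ℝ) ≤ n * T0 := by
      have a := sum_le_card_nsmul (P.filter (fun p => ¬ T 0 ≤ (deg C p : ℝ)))
        (fun p => (deg C p : ℝ)) T0 (by
          intro p hp
          have := (mem_filter.1 hp).2
          rw [hTz] at this
          exact (not_le.1 this).le)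
      rw [nsmul_eq_mul] at a
      refine a.trans ?_
      rw [hn]
      gcongr
      exact filter_subset _ _
    have e3 : UU C P (T 0) = P.filter (fun p => T 0 ≤ (deg C p : ℝ)) := by
      unfold UU
      rfl
    rw [e3]
    rw [← hI] at e1
    have : n * T0 = I / 2 := by rw [hIt]; ring
    linarith
  rw [← hI, hTs 0, pow_zero, mul_one] at h1
  rw [← hL, ← hn] at h2
  set S := ∑ j ∈ range (J + 1),
    ((LE τ C (UU C P (T j)) (ε * T (j+1)) (xx C (T (j+1)))).card : ℝ) with hS
  have hI0 : 0 ≤ I := by rw [hIt]; positivity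
  have c1 : L * (2 * (96 * ε * I)) = I / 16 := by
    rw [hε]; field_simp; ring
  have c2 : L * (2 * (2 / (ε * B) * I)) = I / 16 := by
    rw [hB]; field_simp; ring
  have c3 : L * (n * (k.factorial * (2 * (α * t) / ε) ^ k)) ≤ I / 16 := by
    have q : 2 * (α * t) / ε = 1 / (8 * L * k.factorial) * t := by
      rw [hα]; field_simp; norm_num
    rw [q, mul_pow]
    have q1 : (1 / (8 * L * (k.factorial : ℝ))) ^ k ≤ 1 / (8 * L * k.factorial) := by
      apply pow_le_of_le_one (by positivity) _ (by omega)
      rw [div_le_one (by positivity)]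
      nlinarith
    calc L * (n * (k.factorial * ((1 / (8 * L * (k.factorial : ℝ))) ^ k * t ^ k)))
        ≤ L * (n * (k.factorial * ((1 / (8 * L * (k.factorial : ℝ))) * t ^ k))) := by gcongr
      _ = I / 16 := by rw [hIt, hT0]; field_simp; ring
  have h4 : I / 2 ≤ L * C.card + 2 * L * S + L * (n * (k.factorial * (2 * (α * t) / ε) ^ k)) := by
    refine (h3.trans h2).trans (le_of_eq (by ring))
  have h5 : L * (2 * S) ≤ L * (2 * (96 * ε * I + 2 / (ε * B) * I + 2 * ((2 * m : ℕ) : ℝ) / (ε * T1))) := by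
    gcongr
  have h6 : I / 4 ≤ L * (2 * (2 * ((2 * m : ℕ) : ℝ) / (ε * T1))) := by
    have : L * (2 * (96 * ε * I + 2 / (ε * B) * I + 2 * ((2 * m : ℕ) : ℝ) / (ε * T1))) =
      L * (2 * (96 * ε * I)) + L * (2 * (2 / (ε * B) * I)) +
      L * (2 * (2 * ((2 * m : ℕ) : ℝ) / (ε * T1))) := by ring
    nlinarith
  push_cast at h6
  have h7 : L * (2 * (2 * (2 * (m:ℝ)) / (ε * T1))) = 8 * L * m / (ε * T1) := by ring
  rw [h7, le_div_iff₀ (by positivity), hIt, hT1, hT0] at h6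
  have h8 : 16 * L / (ε * α) * (m:ℝ) = 16 * L * m / (ε * α) := by ring
  rw [h8, le_div_iff₀ (by positivity)]
  have h9 : n * t ^ (2 * k + 1) * (ε * α) = 2 * (2 * n * t ^ k / 4 * (ε * (α * t * t ^ k))) := by
    ring
  rw [h9]
  linarith

lemma final (k : ℕ) (hk : 1 ≤ k) :
    ∃ c : ℝ, 0 < c ∧
      ∀ P : Finset (ℝ × ℝ), ∀ C : Finset (Set (ℝ × ℝ)), ∀ m : ℕ,
        KIntersecting C k →
        2 * m = ∑ e ∈ C.offDiag, ((e.1 ∩ e.2) \ (↑P : Set (ℝ × ℝ))).ncard →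
        (incidences P C : ℝ) ≤
          c * ((P.card : ℝ) ^ (((k:ℝ) + 1) / (2 * (k:ℝ) + 1)) *
                 (m : ℝ) ^ ((k:ℝ) / (2 * (k:ℝ) + 1)) + (P.card : ℝ) + (C.card : ℝ)) := by
  obtain ⟨L, hL⟩ : ∃ L : ℝ, L = 2 ^ k := ⟨_, rfl⟩
  obtain ⟨ε, hε⟩ : ∃ ε : ℝ, ε = 1 / (3072 * L) := ⟨_, rfl⟩
  obtain ⟨B, hB⟩ : ∃ B : ℝ, B = 64 * L / ε := ⟨_, rfl⟩
  obtain ⟨α, hα⟩ : ∃ α : ℝ, α = ε / (16 * L * k.factorial) := ⟨_, rfl⟩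
  have hL0 : 0 < L := by rw [hL]; positivity
  have hf0 : (0:ℝ) < k.factorial := by exact_mod_cast k.factorial_pos
  have hε0 : 0 < ε := by rw [hε]; positivity
  have hB0 : 0 < B := by rw [hB]; positivity
  have hα0 : 0 < α := by rw [hα]; positivity
  set K : ℝ := 16 * L / (ε * α) + 1 with hK
  have hK1 : 1 ≤ K := by rw [hK]; have : 0 ≤ 16 * L / (ε * α) := by positivity
                         linarith
  refine ⟨16 * L + 2 * (B / α) ^ k + 2 * K, by positivity, ?_⟩
  intro P C m hC hm
  set X : ℝ := (P.card : ℝ) ^ (((k:ℝ) + 1) / (2 * (k:ℝ) + 1)) *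
                 (m : ℝ) ^ ((k:ℝ) / (2 * (k:ℝ) + 1)) with hX
  have hX0 : 0 ≤ X := by positivity
  have hc1 : 0 ≤ 2 * (B / α) ^ k := by positivity
  have hP0 : (0:ℝ) ≤ P.card := by positivity
  have hC0 : (0:ℝ) ≤ C.card := by positivity
  have hI := inc_eq P C
  set I : ℝ := (incidences P C : ℝ) with hIdef
  have hI0 : 0 ≤ I := by positivity
  have hexp : (16 * L + 2 * (B / α) ^ k + 2 * K) * (X + P.card + C.card) =
      16 * L * C.card + 2 * (B / α) ^ k * P.card + 2 * K * X +
      (16 * L * (X + P.card) + 2 * (B / α) ^ k * (X + C.card) + 2 * K * (P.card + C.card)) := by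
    ring
  have hrest : 0 ≤ 16 * L * (X + P.card) + 2 * (B / α) ^ k * (X + C.card) +
      2 * K * (P.card + C.card) := by positivity
  have q1 : 0 ≤ 16 * L * (C.card : ℝ) := by positivity
  have q2 : 0 ≤ 2 * (B / α) ^ k * (P.card : ℝ) := by positivity
  have q3 : 0 ≤ 2 * K * X := by positivity
  rw [hexp]
  by_cases hcase1 : I ≤ 16 * L * C.card
  · linarith
  push Not at hcase1
  by_cases hcase2 : I ≤ 2 * (B / α) ^ k * P.card
  · linarith
  push Not at hcase2
  have hIpos : 0 < I := by linarith
  have hn : 0 < (P.card : ℝ) := by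
    rcases hP0.lt_or_eq with h | h
    · exact h
    · exfalso
      have : P = ∅ := by
        rw [← card_eq_zero]; exact_mod_cast h.symm
      rw [this, sum_empty] at hI
      linarith
  set t : ℝ := (I / (2 * P.card)) ^ ((1:ℝ) / k) with htdef
  have hk0 : (k:ℝ) ≠ 0 := by positivity
  have ht : 0 < t := by positivity
  have htk : t ^ k = I / (2 * P.card) := by
    rw [htdef, ← Real.rpow_natCast, ← Real.rpow_mul (by positivity), one_div,
      inv_mul_cancel₀ hk0, Real.rpow_one]
  have hIt : I = 2 * P.card * t ^ k := by
    have aux : ∀ x y : ℝ, 0 < y → x = 2 * y * (x / (2 * y)) := by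
      intro x y hy
      field_simp
    rw [htk]
    exact aux I _ hn
  have htB : B ≤ α * t := by
    by_contra hlt
    push Not at hlt
    have h1 : t ≤ B / α := by rw [le_div_iff₀ hα0]; linarith
    have h2 : t ^ k ≤ (B / α) ^ k := pow_le_pow_left₀ ht.le h1 k
    nlinarith
  have hcore := core k hk P C m hC hm L ε B α t I P.card hL hε hB hα ht hI rfl hIt htB hcase1.le
  have hm0 : (0:ℝ) ≤ m := by positivity
  have := rpow_final k hk P.card t K m hn ht hK1 hm0 (hcore.trans (by rw [hK]; linarith))
  rw [← hX] at this
  nlinarith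

end PS

theorem pach_sharir_crossings (k : ℕ) (hk : 1 ≤ k) :
    ∃ c : ℝ, 0 < c ∧
      ∀ P : Finset (ℝ × ℝ), ∀ C : Finset (Set (ℝ × ℝ)), ∀ m : ℕ,
        KIntersecting C k →
        2 * m = ∑ e ∈ C.offDiag, ((e.1 ∩ e.2) \ (↑P : Set (ℝ × ℝ))).ncard →
        (incidences P C : ℝ) ≤
          c * ((P.card : ℝ) ^ (((k:ℝ) + 1) / (2 * (k:ℝ) + 1)) *
                 (m : ℝ) ^ ((k:ℝ) / (2 * (k:ℝ) + 1)) + (P.card : ℝ) + (C.card : ℝ)) := by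
  exact PS.final k hk
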